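/- Let $t \ge 4.5$ be a real number and let $G$ be a $t$-tough $(P_4 \cup P_1)$-free graph on $n$ vertices with a cutset $S \subseteq V(G)$. Suppose $S_0 \subseteq S$ admits an ordering $x_1, x_2, \ldots, x_{s_0}$ of its vertices such that for each $i$, the vertex $x_i$ has more than $\frac{n}{t+1} - 1$ neighbors in $(V(G) \setminus S) \cup \{x_1, \ldots, x_{i-1}\}$. Then $G$ has a cycle whose vertex set contains $(V(G) \setminus S) \cup S_0$. -/

import Mathlib

open SimpleGraph

/-- The number of connected components of `G - S`. -/
noncomputable def ncomps {V : Type*} (G : SimpleGraph V) (S : Set V) : ℕ :=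
  Nat.card (G.induce Sᶜ).ConnectedComponent

/-- The graph `P₄ ∪ P₁`: a path on four vertices plus an isolated vertex. -/
def P4P1 : SimpleGraph (Fin 5) :=
  SimpleGraph.fromEdgeSet {s((0 : Fin 5), (1 : Fin 5)), s((1 : Fin 5), (2 : Fin 5)),
    s((2 : Fin 5), (3 : Fin 5))}

/-- `G` has no induced subgraph isomorphic to `P₄ ∪ P₁`. -/
def P4P1Free {V : Type*} (G : SimpleGraph V) : Prop := IsEmpty (P4P1 ↪g G)

/-- `G` has no induced subgraph isomorphic to `P₄`. -/
def P4Free {V : Type*} (G : SimpleGraph V) : Prop := IsEmpty (SimpleGraph.pathGraph 4 ↪g G)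

/-- `G` is `t`-tough. -/
def Tough {V : Type*} (t : ℝ) (G : SimpleGraph V) : Prop :=
  ∀ S : Set V, 2 ≤ ncomps G S → t * (ncomps G S : ℝ) ≤ (S.ncard : ℝ)

/-- `S` is a cutset of `G`, i.e. `G - S` is disconnected. -/
def IsCutset {V : Type*} (G : SimpleGraph V) (S : Set V) : Prop :=
  2 ≤ ncomps G S

/-- `S` is a scattering set of `G`. -/
def IsScatSet {V : Type*} (G : SimpleGraph V) (S : Set V) : Prop :=
  2 ≤ ncomps G S ∧ ∀ T : Set V, 2 ≤ ncomps G T →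
    (ncomps G T : ℤ) - (T.ncard : ℤ) ≤ (ncomps G S : ℤ) - (S.ncard : ℤ)

/-- `S` is a maximal scattering set of `G`. -/
def IsMaxScatSet {V : Type*} (G : SimpleGraph V) (S : Set V) : Prop :=
  IsScatSet G S ∧ ∀ T : Set V, IsScatSet G T → S ⊆ T → S = T

/-- `G` is `t`-tough with respect to `S`. -/
def ToughWrt {V : Type*} (t : ℝ) (G : SimpleGraph V) (S : Set V) : Prop :=
  ∀ W : Set V, 2 ≤ ncomps G W →
    (∀ c : (G.induce Sᶜ).ConnectedComponent,
      ∃ v : ↥Sᶜ, (G.induce Sᶜ).connectedComponentMk v = c ∧ (v : V) ∉ W) →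
    t * (ncomps G W : ℝ) ≤ (W.ncard : ℝ)

section

variable {V : Type*} {G : SimpleGraph V}

/-- `u` and `v` are joined by a walk of `G` all of whose vertices lie in `X`. -/
def ConnIn (G : SimpleGraph V) (X : Set V) (u v : V) : Prop :=
  ∃ p : G.Walk u v, ∀ w ∈ p.support, w ∈ X

namespace ConnIn

variable {X Y : Set V} {u v w : V}

lemma refl (h : u ∈ X) : ConnIn G X u u := ⟨.nil, by simpa using h⟩

lemma symm (h : ConnIn G X u v) : ConnIn G X v u := by
  obtain ⟨p, hp⟩ := h
  exact ⟨p.reverse, by simpa using hp⟩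

lemma trans (h : ConnIn G X u v) (h' : ConnIn G X v w) : ConnIn G X u w := by
  obtain ⟨p, hp⟩ := h
  obtain ⟨q, hq⟩ := h'
  refine ⟨p.append q, fun z hz => ?_⟩
  rcases (Walk.mem_support_append_iff p q).1 hz with hz | hz
  exacts [hp z hz, hq z hz]

lemma left_mem (h : ConnIn G X u v) : u ∈ X := by
  obtain ⟨p, hp⟩ := h
  exact hp u p.start_mem_support

lemma right_mem (h : ConnIn G X u v) : v ∈ X := h.symm.left_mem

lemma mono (hXY : X ⊆ Y) (h : ConnIn G X u v) : ConnIn G Y u v := by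
  obtain ⟨p, hp⟩ := h
  exact ⟨p, fun w hw => hXY (hp w hw)⟩

lemma of_adj (hu : u ∈ X) (hv : v ∈ X) (h : G.Adj u v) : ConnIn G X u v :=
  ⟨h.toWalk, by simp [hu, hv]⟩

/-- A set that is closed under adjacency within `X` contains everything reachable from it. -/
lemma closed {D : Set V} (hD : ∀ a ∈ D, ∀ b ∈ X, a ∈ X → G.Adj a b → b ∈ D)
    (h : ConnIn G X u v) (hu : u ∈ D) : v ∈ D := by
  obtain ⟨p, hp⟩ := h
  induction p with
  | nil => exact hu
  | cons hadj p ih =>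
    exact ih (hD _ hu _ (hp _ (by simp)) (hp _ (by simp)) hadj)
      (fun w hw => hp w (by simp [hw]))

lemma exists_crossing {D : Set V} (h : ConnIn G X u v) (hu : u ∈ D) (hv : v ∉ D) :
    ∃ a b, a ∈ D ∧ b ∉ D ∧ a ∈ X ∧ b ∈ X ∧ G.Adj a b ∧ ConnIn G X u a := by
  by_contra! hcon
  refine hv (closed (D := {z | z ∈ D ∧ ConnIn G X u z}) ?_ h ⟨hu, .refl h.left_mem⟩).1
  rintro a ⟨ha, hua⟩ b hb haX hab
  refine ⟨?_, hua.trans (.of_adj haX hb hab)⟩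
  by_contra hbD
  exact hcon a b ha hbD haX hb hab hua

end ConnIn

lemma Tough.mul_card_le [Finite V] {t : ℝ} (h : Tough t G) (ht : 0 ≤ t) {I : Finset V} {Z : Set V}
    (hIZ : ∀ i ∈ I, i ∉ Z) (hI : ∀ i ∈ I, ∀ j ∈ I, i ≠ j → ¬ ConnIn G Zᶜ i j)
    (h2 : 2 ≤ I.card) : t * I.card ≤ Z.ncard := by
  have hle : I.card ≤ ncomps G Z := by
    have : Function.Injective (fun i : I =>
        (G.induce Zᶜ).connectedComponentMk ⟨i.1, hIZ i.1 i.2⟩) := by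
      intro i j hij
      by_contra hne
      obtain ⟨p⟩ := ConnectedComponent.exact hij
      refine hI i i.2 j j.2 (fun h => hne (Subtype.ext h)) ⟨p.map (Embedding.induce Zᶜ).toHom, ?_⟩
      intro w hw
      obtain ⟨z, -, rfl⟩ := List.mem_map.1 ((Walk.support_map _ p) ▸ hw :)
      exact z.2
    have h1 := Nat.card_le_card_of_injective _ this
    simpa [ncomps] using h1
  calc t * I.card ≤ t * ncomps G Z := by gcongr
    _ ≤ _ := h Z (h2.trans hle)

lemma P4P1Free.false_of_adj (h : P4P1Free G) {a b c d e : V} (hab : G.Adj a b) (hbc : G.Adj b c)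
    (hcd : G.Adj c d) (hac : ¬ G.Adj a c) (had : ¬ G.Adj a d) (hbd : ¬ G.Adj b d)
    (hac' : a ≠ c) (had' : a ≠ d) (hbd' : b ≠ d)
    (hea : e ≠ a) (heb : e ≠ b) (hec : e ≠ c) (hed : e ≠ d)
    (ha : ¬ G.Adj e a) (hb : ¬ G.Adj e b) (hc : ¬ G.Adj e c) (hd : ¬ G.Adj e d) : False := by
  refine h.false ⟨⟨![a, b, c, d, e], ?_⟩, ?_⟩
  · intro i j hij
    have := hab.ne
    have := hbc.ne
    have := hcd.ne
    fin_cases i <;> fin_cases j <;> simp_all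
  · intro i j
    change G.Adj (![a, b, c, d, e] i) (![a, b, c, d, e] j) ↔ _
    simp only [P4P1, fromEdgeSet_adj]
    fin_cases i <;> fin_cases j <;> simp_all [G.adj_comm]

/-- Every walk on four vertices of `F` has a chord, i.e. `F` induces no path on four vertices. -/
def NoP4On (G : SimpleGraph V) (F : Set V) : Prop :=
  ∀ a ∈ F, ∀ b ∈ F, ∀ c ∈ F, ∀ d ∈ F, G.Adj a b → G.Adj b c → G.Adj c d →
    a ≠ c → a ≠ d → b ≠ d → G.Adj a c ∨ G.Adj a d ∨ G.Adj b d

lemma NoP4On.mono {F F' : Set V} (h : NoP4On G F) (hF : F' ⊆ F) : NoP4On G F' :=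
  fun a ha b hb c hc d hd => h a (hF ha) b (hF hb) c (hF hc) d (hF hd)

lemma NoP4On.compl {F : Set V} (h : NoP4On G F) : NoP4On Gᶜ F := by
  intro a ha b hb c hc d hd hab hbc hcd hac had hbd
  by_contra! hcon
  simp only [compl_adj, not_and, not_not] at *
  obtain ⟨h1, h2, h3⟩ := hcon
  have := h b hb d hd a ha c hc (h3 hbd) (h2 had).symm (h1 hac) hab.1.symm hbc.1 hcd.1.symm
  rcases this with h | h | h
  · exact hab.2 h.symm
  · exact hbc.2 h
  · exact hcd.2 h.symm

lemma P4P1Free.not_connIn_of_indep (hfree : P4P1Free G) {I : Finset V}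
    (hI : ∀ i ∈ I, ∀ j ∈ I, ¬ G.Adj i j) (hcard : 5 ≤ I.card) {i j : V} (hi : i ∈ I) (hj : j ∈ I)
    (hij : i ≠ j) :
    ¬ ConnIn G {v | ∃ i ∈ I, ∃ j ∈ I, i ≠ j ∧ G.Adj v i ∧ G.Adj v j}ᶜ i j := by
  classical
  intro hconn
  set W : Set V := {v | ∃ i ∈ I, ∃ j ∈ I, i ≠ j ∧ G.Adj v i ∧ G.Adj v j}
  have hW : ∀ {v k l}, v ∈ Wᶜ → k ∈ I → l ∈ I → G.Adj v k → G.Adj v l → k = l := by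
    intro v k l hv hk hl hvk hvl
    by_contra hne
    exact hv ⟨k, hk, l, hl, hne, hvk, hvl⟩
  have key := ConnIn.closed (D := {v | v = i ∨ G.Adj v i ∨ ∃ u ∈ Wᶜ, G.Adj u i ∧ G.Adj u v})
    ?_ hconn (Or.inl rfl)
  · rcases key with h | h | ⟨u, hu, hui, huj⟩
    · exact hij h.symm
    · exact hI j hj i hi h
    · exact hij (hW hu hi hj hui huj)
  rintro a ha b hb haW hab
  by_contra hbD
  simp only [Set.mem_ofPred_eq, not_or, not_exists, not_and] at hbD ha
  obtain ⟨hbi, hbi', hbu⟩ := hbD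
  rcases ha with rfl | ha | ⟨u, hu, hui, hua⟩
  · exact hbi' hab.symm
  · exact hbu a haW ha hab
  have hai : a ≠ i := by rintro rfl; exact hbi' hab.symm
  have hai' : ¬ G.Adj a i := fun h => hbu a haW h hab
  have hbad : ∀ v ∈ Wᶜ, (I.filter fun k => k = v ∨ G.Adj v k).card ≤ 1 := by
    intro v hv
    refine Finset.card_le_one.2 fun k hk l hl => ?_
    simp only [Finset.mem_filter] at hk hl
    obtain ⟨hk, rfl | hk'⟩ := hk <;> obtain ⟨hl, rfl | hl'⟩ := hl
    · rfl
    · exact (hI _ hk _ hl hl').elim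
    · exact (hI _ hl _ hk hk').elim
    · exact hW hv hk hl hk' hl'
  obtain ⟨k, hk, hk'⟩ : ∃ k ∈ I, k ∉ {i} ∪ (I.filter fun k => k = a ∨ G.Adj a k) ∪
      (I.filter fun k => k = b ∨ G.Adj b k) := by
    by_contra! hcon
    have h1 := Finset.card_le_card (show I ⊆ _ from hcon)
    have h2 := Finset.card_union_le ({i} ∪ (I.filter fun k => k = a ∨ G.Adj a k))
      (I.filter fun k => k = b ∨ G.Adj b k)
    have h3 := Finset.card_union_le {i} (I.filter fun k => k = a ∨ G.Adj a k)
    have h4 := hbad a haW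
    have h5 := hbad b hb
    simp only [Finset.card_singleton] at h3
    omega
  simp only [Finset.mem_union, Finset.mem_singleton, Finset.mem_filter, hk, true_and, not_or] at hk'
  obtain ⟨⟨hki, hka, hka'⟩, hkb, hkb'⟩ := hk'
  refine hfree.false_of_adj (e := k) hui.symm hua hab (fun h => hai' h.symm) (fun h => hbi' h.symm)
    (fun h => hbu u hu hui h) hai.symm (fun h => hbi h.symm) ?_ hki ?_ hka hkb
    (hI k hk i hi) ?_ (fun h => hka' h.symm) (fun h => hkb' h.symm)
  · rintro rfl; exact hbi' hui
  · rintro rfl; exact hI _ hk _ hi hui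
  · exact fun h => hki (hW hu hk hi h.symm hui)

lemma P4P1Free.mul_card_le_ncard [Finite V] {t : ℝ} (hfree : P4P1Free G) (htough : Tough t G)
    (ht : 0 ≤ t) {I : Finset V} (hI : ∀ i ∈ I, ∀ j ∈ I, ¬ G.Adj i j) (hcard : 5 ≤ I.card) :
    t * I.card ≤ {v | ∃ i ∈ I, ∃ j ∈ I, i ≠ j ∧ G.Adj v i ∧ G.Adj v j}.ncard := by
  refine htough.mul_card_le ht ?_ (fun i hi j hj hij => hfree.not_connIn_of_indep hI hcard hi hj hij)
    (by omega)
  rintro i hi ⟨k, hk, -, -, -, h, -⟩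
  exact hI i hi k hk h

/-- `F` splits into two nonempty parts with no edges of `G` between them. -/
def Separates (G : SimpleGraph V) (F : Set V) : Prop :=
  ∃ A ⊆ F, A.Nonempty ∧ (F \ A).Nonempty ∧ ∀ a ∈ A, ∀ b ∈ F \ A, ¬ G.Adj a b

lemma NoP4On.separates_insert {F : Set V} {v : V} (hv : v ∉ F) (h : NoP4On G (insert v F))
    (hF : Separates G F) : Separates G (insert v F) ∨ Separates Gᶜ (insert v F) := by
  by_cases hall : ∀ w ∈ F, G.Adj v w
  · right
    obtain ⟨A, hAF, ⟨a, ha⟩, -, -⟩ := hF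
    refine ⟨{v}, by simp, by simp, ⟨a, by simp [hAF ha], ?_⟩, ?_⟩
    · rintro rfl; exact hv (hAF ha)
    · rintro _ rfl b ⟨hb, hb'⟩ hadj
      rcases hb with rfl | hb
      · exact hb' rfl
      · exact hadj.2 (hall b hb)
  left
  push Not at hall
  obtain ⟨w, hw, hvw⟩ := hall
  by_contra hsep
  have hD : ∀ D : Set V, D ⊆ F → D.Nonempty → (∀ a ∈ D, ∀ b ∈ F \ D, ¬ G.Adj a b) →
      ∃ a ∈ D, G.Adj v a := by
    intro D hDF hDne hD
    by_contra! hcon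
    refine hsep ⟨D, hDF.trans (Set.subset_insert _ _), hDne,
      ⟨v, Set.mem_insert _ _, fun h => hv (hDF h)⟩, ?_⟩
    rintro a ha b ⟨rfl | hb, hb'⟩ hab
    · exact hcon a ha hab.symm
    · exact hD a ha b ⟨hb, hb'⟩ hab
  obtain ⟨y, hyF, hvy, hy⟩ : ∃ y ∈ F, G.Adj v y ∧ ¬ ConnIn G F w y := by
    obtain ⟨A, hAF, hA, hA', hAB⟩ := hF
    have hcl : ∀ a ∈ A, ∀ b ∈ F, a ∈ F → G.Adj a b → b ∈ A := by
      intro a ha b hb _ hab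
      by_contra hbA
      exact hAB a ha b ⟨hb, hbA⟩ hab
    by_cases hwA : w ∈ A
    · obtain ⟨y, hy, hvy⟩ := hD (F \ A) Set.sdiff_subset hA' (by
        rintro a ha b ⟨hb, hb'⟩ hab
        exact hAB b (by_contra fun h => hb' ⟨hb, h⟩) a ha hab.symm)
      exact ⟨y, hy.1, hvy, fun h => hy.2 (h.closed hcl hwA)⟩
    · obtain ⟨y, hy, hvy⟩ := hD A hAF hA hAB
      exact ⟨y, hAF hy, hvy, fun h => hwA (h.symm.closed hcl hy)⟩
  obtain ⟨z, hwz, hvz⟩ := hD {z | ConnIn G F w z} (fun z hz => hz.right_mem) ⟨w, .refl hw⟩ (by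
    rintro a ha b ⟨hb, hb'⟩ hab
    exact hb' (ConnIn.trans ha (.of_adj (ConnIn.right_mem ha) hb hab)))
  obtain ⟨p, q, hp, hq, hpF, hqF, hpq, hwp⟩ := ConnIn.exists_crossing (D := {z | ¬ G.Adj v z}) hwz hvw
    (not_not.2 hvz)
  have hq : G.Adj v q := not_not.1 hq
  have hwq := hwp.trans (.of_adj hpF hqF hpq)
  have hno : ∀ z, ConnIn G F w z → z ≠ y ∧ ¬ G.Adj z y := by
    refine fun z hz => ⟨?_, fun h => hy (hz.trans (.of_adj hz.right_mem hyF h))⟩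
    rintro rfl
    exact hy hz
  rcases h p (by simp [hpF]) q (by simp [hqF]) v (by simp) y (by simp [hyF]) hpq hq.symm hvy
    (fun h => hv (h ▸ hpF)) (hno p hwp).1 (hno q hwq).1 with h | h | h
  · exact hp h.symm
  · exact (hno p hwp).2 h
  · exact (hno q hwq).2 h

/-- Seinsche's theorem. -/
lemma NoP4On.separates_or (F : Finset V) (h : NoP4On G (F : Set V)) (hF : 2 ≤ F.card) :
    Separates G (F : Set V) ∨ Separates Gᶜ (F : Set V) := by
  classical
  induction F using Finset.induction with
  | empty => simp at hF
  | insert v F hv ih =>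
    rw [Finset.card_insert_of_notMem hv] at hF
    rw [Finset.coe_insert] at h ⊢
    rcases Nat.lt_or_ge F.card 2 with h1 | h1
    · obtain ⟨w, rfl⟩ := Finset.card_eq_one.1 (show F.card = 1 by omega)
      have hvw : v ≠ w := by simpa using hv
      by_cases hadj : G.Adj v w
      · refine Or.inr ⟨{v}, by simp, by simp, ⟨w, by simp [hvw.symm]⟩, ?_⟩
        simp +contextual [hadj]
      · refine Or.inl ⟨{v}, by simp, by simp, ⟨w, by simp [hvw.symm]⟩, ?_⟩
        simp +contextual [hadj]
    · rcases ih (h.mono (Set.subset_insert _ _)) h1 with h2 | h2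
      · exact h.separates_insert (by simpa using hv) h2
      · simpa [or_comm] using h.compl.separates_insert (by simpa using hv) h2

/-- The vertices of `F` are partitioned into the vertex sets of `q` paths of `G`. -/
def PathCover (G : SimpleGraph V) (F : Finset V) (q : ℕ) : Prop :=
  ∃ ps : List (List V), ps.length = q ∧ (∀ p ∈ ps, p ≠ [] ∧ p.IsChain G.Adj) ∧
    (ps.flatten : Multiset V) = F.val

lemma List.length_le_length_flatten {α : Type*} {ps : List (List α)} (h : ∀ p ∈ ps, p ≠ []) :
    ps.length ≤ ps.flatten.length := by
  induction ps with
  | nil => simp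
  | cons p ps ih =>
    have := List.length_pos_iff.2 (h p (by simp))
    have := ih fun q hq => h q (by simp [hq])
    simp only [List.length_cons, List.flatten_cons, List.length_append]
    omega

namespace PathCover

variable {F F₁ F₂ : Finset V} {p q r : ℕ}

lemma le_card (h : PathCover G F q) : q ≤ F.card := by
  obtain ⟨ps, rfl, hps, hF⟩ := h
  rw [Finset.card_def, ← hF, Multiset.coe_card]
  exact List.length_le_length_flatten fun p hp => (hps p hp).1

lemma succ (h : PathCover G F q) (hq : q < F.card) : PathCover G F (q + 1) := by
  obtain ⟨ps, rfl, hps, hF⟩ := h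
  obtain ⟨p, hp, hlen⟩ : ∃ p ∈ ps, 2 ≤ p.length := by
    by_contra! hcon
    have : ∀ ps : List (List V), (∀ p ∈ ps, p.length < 2) → ps.flatten.length ≤ ps.length := by
      intro ps h
      induction ps with
      | nil => simp
      | cons p ps ih =>
        have := h p (by simp)
        have := ih fun q hq => h q (by simp [hq])
        simp only [List.length_cons, List.flatten_cons, List.length_append]
        omega
    have := this ps hcon
    rw [Finset.card_def, ← hF, Multiset.coe_card] at hq
    omega
  obtain ⟨s, t, rfl⟩ := List.append_of_mem hp
  match p, hlen with
  | a :: b :: l, _ =>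
    have hab := hps (a :: b :: l) (by simp)
    refine ⟨s ++ [a] :: (b :: l) :: t, by simp; omega, ?_, by simpa using hF⟩
    intro x hx
    simp only [List.mem_append, List.mem_cons] at hx
    rcases hx with hx | rfl | rfl | hx
    · exact hps x (by simp [hx])
    · simp
    · exact ⟨by simp, hab.2.tail⟩
    · exact hps x (by simp [hx])

lemma mono (h : PathCover G F q) (hqr : q ≤ r) (hr : r ≤ F.card) : PathCover G F r := by
  induction r, hqr using Nat.le_induction with
  | base => exact h
  | succ r _ ih => exact (ih (by omega)).succ (by omega)

lemma union [DecidableEq V] (hd : Disjoint F₁ F₂) (h₁ : PathCover G F₁ p) (h₂ : PathCover G F₂ q) :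
    PathCover G (F₁ ∪ F₂) (p + q) := by
  obtain ⟨ps, rfl, hps, hF₁⟩ := h₁
  obtain ⟨qs, rfl, hqs, hF₂⟩ := h₂
  refine ⟨ps ++ qs, by simp, ?_, ?_⟩
  · intro x hx
    rcases List.mem_append.1 hx with hx | hx
    exacts [hps x hx, hqs x hx]
  · rw [← Finset.disjUnion_eq_union _ _ hd, Finset.disjUnion_val, ← hF₁, ← hF₂]
    simp

lemma singletons (G : SimpleGraph V) (F : Finset V) : PathCover G F F.card := by
  refine ⟨F.toList.map fun v => [v], by simp, by simp, ?_⟩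
  simp [← List.flatMap_def]

private lemma exists_merge {A B : Set V} (hAB : ∀ a ∈ A, ∀ b ∈ B, G.Adj a b) :
    ∀ rs ps : List (List V), (∀ a ∈ ps, (a ≠ [] ∧ a.IsChain G.Adj) ∧
      (∀ u ∈ a.head?, u ∈ A) ∧ ∀ u ∈ a.getLast?, u ∈ A) →
    (∀ x ∈ rs, (x ≠ [] ∧ x.IsChain G.Adj) ∧ ∀ u ∈ x, u ∈ B) → rs.length < ps.length →
    ∃ qs : List (List V), (∀ a ∈ qs, (a ≠ [] ∧ a.IsChain G.Adj) ∧
      (∀ u ∈ a.head?, u ∈ A) ∧ ∀ u ∈ a.getLast?, u ∈ A) ∧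
      qs.length = ps.length - rs.length ∧ qs.flatten.Perm (ps.flatten ++ rs.flatten) := by
  intro rs
  induction rs with
  | nil => intro ps h _ _; exact ⟨ps, h, by simp, by simp⟩
  | cons x rs ih =>
    intro ps hps hrs hlen
    match ps, hlen with
    | [a], h => simp at h
    | a :: b :: ps, hlen =>
      have ha := hps a (by simp)
      have hb := hps b (by simp)
      have hx := hrs x (by simp)
      obtain ⟨qs, hqs, hl, hperm⟩ := ih ((a ++ x ++ b) :: ps) (by
        intro c hc
        rcases List.mem_cons.1 hc with rfl | hc
        · refine ⟨⟨by simp [ha.1.1], ?_⟩, ?_, ?_⟩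
          · rw [List.append_assoc, List.isChain_append, List.isChain_append]
            refine ⟨ha.1.2, ⟨hx.1.2, hb.1.2, ?_⟩, ?_⟩
            · intro u hu v hv
              exact (hAB v (hb.2.1 v hv) u (hx.2 u (List.mem_of_getLast? hu))).symm
            · intro u hu v hv
              rw [List.head?_append_of_ne_nil _ hx.1.1] at hv
              exact hAB u (ha.2.2 u hu) v (hx.2 v (List.mem_of_head? hv))
          · rw [List.append_assoc, List.head?_append_of_ne_nil _ ha.1.1]
            exact ha.2.1
          · rw [List.getLast?_append_of_ne_nil _ hb.1.1]
            exact hb.2.2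
        · exact hps c (by simp [hc])) (fun y hy => hrs y (by simp [hy])) (by simp at hlen ⊢; omega)
      refine ⟨qs, hqs, by simp at hl ⊢; omega, hperm.trans ?_⟩
      rw [← Multiset.coe_eq_coe]
      simp only [List.flatten_cons, ← Multiset.coe_add]
      abel

lemma join_lt [DecidableEq V] (hd : Disjoint F₁ F₂) (hadj : ∀ a ∈ F₁, ∀ b ∈ F₂, G.Adj a b)
    (h₁ : PathCover G F₁ p) (h₂ : PathCover G F₂ q) (hqp : q < p) :
    PathCover G (F₁ ∪ F₂) (p - q) := by
  obtain ⟨ps, rfl, hps, hF₁⟩ := h₁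
  obtain ⟨qs, rfl, hqs, hF₂⟩ := h₂
  have m₁ : ∀ a ∈ ps, ∀ u ∈ a, u ∈ F₁ := fun a ha u hu => by
    rw [← Finset.mem_val, ← hF₁]; exact List.mem_flatten.2 ⟨a, ha, hu⟩
  have m₂ : ∀ a ∈ qs, ∀ u ∈ a, u ∈ F₂ := fun a ha u hu => by
    rw [← Finset.mem_val, ← hF₂]; exact List.mem_flatten.2 ⟨a, ha, hu⟩
  obtain ⟨rs, hrs, hl, hperm⟩ := exists_merge (A := F₁) (B := F₂) hadj qs ps
    (fun a ha => ⟨hps a ha, fun u hu => m₁ a ha u (List.mem_of_head? hu),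
      fun u hu => m₁ a ha u (List.mem_of_getLast? hu)⟩)
    (fun x hx => ⟨hqs x hx, m₂ x hx⟩) hqp
  refine ⟨rs, hl, fun a ha => (hrs a ha).1, ?_⟩
  rw [← Finset.disjUnion_eq_union _ _ hd, Finset.disjUnion_val, ← hF₁, ← hF₂, Multiset.coe_add]
  exact Multiset.coe_eq_coe.2 hperm

lemma join_eq [DecidableEq V] (hd : Disjoint F₁ F₂) (hadj : ∀ a ∈ F₁, ∀ b ∈ F₂, G.Adj a b)
    (h₁ : PathCover G F₁ p) (h₂ : PathCover G F₂ p) (hp : 0 < p) :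
    PathCover G (F₁ ∪ F₂) 1 := by
  obtain ⟨ps, rfl, hps, hF₁⟩ := h₁
  obtain ⟨qs, hlen, hqs, hF₂⟩ := h₂
  have m₁ : ∀ a ∈ ps, ∀ u ∈ a, u ∈ F₁ := fun a ha u hu => by
    rw [← Finset.mem_val, ← hF₁]; exact List.mem_flatten.2 ⟨a, ha, hu⟩
  have m₂ : ∀ a ∈ qs, ∀ u ∈ a, u ∈ F₂ := fun a ha u hu => by
    rw [← Finset.mem_val, ← hF₂]; exact List.mem_flatten.2 ⟨a, ha, hu⟩
  match qs, hlen with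
  | [], h => simp at h; omega
  | x :: qs, hlen =>
    obtain ⟨rs, hrs, hl, hperm⟩ := exists_merge (A := F₁) (B := F₂) hadj qs ps
      (fun a ha => ⟨hps a ha, fun u hu => m₁ a ha u (List.mem_of_head? hu),
        fun u hu => m₁ a ha u (List.mem_of_getLast? hu)⟩)
      (fun y hy => ⟨hqs y (by simp [hy]), m₂ y (by simp [hy])⟩) (by simp at hlen; omega)
    obtain ⟨a, rfl⟩ := List.length_eq_one_iff.1 (show rs.length = 1 by simp at hlen; omega)
    have ha := hrs a (by simp)
    have hx := hqs x (by simp)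
    refine ⟨[a ++ x], rfl, ?_, ?_⟩
    · simp only [List.mem_singleton, forall_eq]
      refine ⟨by simp [hx.1], List.isChain_append.2 ⟨ha.1.2, hx.2, ?_⟩⟩
      exact fun u hu v hv => hadj u (ha.2.2 u hu) v (m₂ x (by simp) v (List.mem_of_head? hv))
    · rw [← Finset.disjUnion_eq_union _ _ hd, Finset.disjUnion_val, ← hF₁, ← hF₂]
      have := Multiset.coe_eq_coe.2 hperm
      simp only [List.flatten_cons, ← Multiset.coe_add, List.flatten_nil] at this ⊢
      simp only [Multiset.coe_nil, add_zero] at this ⊢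
      rw [this]
      abel

end PathCover

/-- `F` has a cover by `q` paths, certified to be optimal by a scattering set `W` whose removal
leaves the members of `I` in different components. -/
def ScatteredCover (G : SimpleGraph V) (F : Finset V) : Prop :=
  ∃ (q : ℕ) (W I : Finset V), PathCover G F q ∧ W ⊆ F ∧ I ⊆ F ∧ Disjoint I W ∧
    W.card + q ≤ I.card ∧ ∀ i ∈ I, ∀ j ∈ I, i ≠ j → ¬ ConnIn G {v | v ∈ F ∧ v ∉ W} i j

namespace ScatteredCover

variable [DecidableEq V] {F₁ F₂ : Finset V}

lemma union (hd : Disjoint F₁ F₂) (hadj : ∀ a ∈ F₁, ∀ b ∈ F₂, ¬ G.Adj a b)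
    (h₁ : ScatteredCover G F₁) (h₂ : ScatteredCover G F₂) : ScatteredCover G (F₁ ∪ F₂) := by
  obtain ⟨p, W₁, I₁, hp, hW₁, hI₁, hd₁, hc₁, hconn₁⟩ := h₁
  obtain ⟨q, W₂, I₂, hq, hW₂, hI₂, hd₂, hc₂, hconn₂⟩ := h₂
  have e₁ : ∀ {v}, v ∈ F₁ → v ∉ F₂ := fun h h' => Finset.disjoint_left.1 hd h h'
  refine ⟨p + q, W₁ ∪ W₂, I₁ ∪ I₂, hp.union hd hq, Finset.union_subset_union hW₁ hW₂,
    Finset.union_subset_union hI₁ hI₂, ?_, ?_, ?_⟩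
  · rw [Finset.disjoint_left] at *
    intro v hv hv'
    rcases Finset.mem_union.1 hv with hv | hv <;> rcases Finset.mem_union.1 hv' with hv' | hv'
    · exact hd₁ hv hv'
    · exact hd (hI₁ hv) (hW₂ hv')
    · exact hd (hW₁ hv') (hI₂ hv)
    · exact hd₂ hv hv'
  · rw [Finset.card_union_of_disjoint (hd.mono hI₁ hI₂)]
    have := Finset.card_union_le W₁ W₂
    omega
  · have hleft : ∀ i ∈ I₁, ∀ j, ConnIn G {v | v ∈ F₁ ∪ F₂ ∧ v ∉ W₁ ∪ W₂} i j →
        ConnIn G {v | v ∈ F₁ ∧ v ∉ W₁} i j := by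
      intro i hi j h
      refine h.closed (D := {z | ConnIn G {v | v ∈ F₁ ∧ v ∉ W₁} i z}) ?_
        (.refl ⟨hI₁ hi, Finset.disjoint_left.1 hd₁ hi⟩)
      rintro a ha b ⟨hb, hb'⟩ - hab
      refine ConnIn.trans ha (.of_adj ha.right_mem ⟨?_, fun h => hb' (by simp [h])⟩ hab)
      exact (Finset.mem_union.1 hb).resolve_right fun hb => hadj a ha.right_mem.1 b hb hab
    have hright : ∀ i ∈ I₂, ∀ j, ConnIn G {v | v ∈ F₁ ∪ F₂ ∧ v ∉ W₁ ∪ W₂} i j →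
        ConnIn G {v | v ∈ F₂ ∧ v ∉ W₂} i j := by
      intro i hi j h
      refine h.closed (D := {z | ConnIn G {v | v ∈ F₂ ∧ v ∉ W₂} i z}) ?_
        (.refl ⟨hI₂ hi, Finset.disjoint_left.1 hd₂ hi⟩)
      rintro a ha b ⟨hb, hb'⟩ - hab
      refine ConnIn.trans ha (.of_adj ha.right_mem ⟨?_, fun h => hb' (by simp [h])⟩ hab)
      exact (Finset.mem_union.1 hb).resolve_left fun hb => hadj b hb a ha.right_mem.1 hab.symm
    intro i hi j hj hij h
    rcases Finset.mem_union.1 hi with hi | hi <;> rcases Finset.mem_union.1 hj with hj | hj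
    · exact hconn₁ i hi j hj hij (hleft i hi j h)
    · exact e₁ (hleft i hi j h).right_mem.1 (hI₂ hj)
    · exact e₁ (hI₁ hj) (hright i hi j h).right_mem.1
    · exact hconn₂ i hi j hj hij (hright i hi j h)

lemma join_of_lt {p : ℕ} {W₁ I₁ : Finset V} (hd : Disjoint F₁ F₂)
    (hadj : ∀ a ∈ F₁, ∀ b ∈ F₂, G.Adj a b) (hp : PathCover G F₁ p) (hW₁ : W₁ ⊆ F₁) (hI₁ : I₁ ⊆ F₁)
    (hd₁ : Disjoint I₁ W₁) (hc₁ : W₁.card + p ≤ I₁.card)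
    (hconn₁ : ∀ i ∈ I₁, ∀ j ∈ I₁, i ≠ j → ¬ ConnIn G {v | v ∈ F₁ ∧ v ∉ W₁} i j)
    (hlt : F₂.card < p) : ScatteredCover G (F₁ ∪ F₂) := by
  refine ⟨p - F₂.card, W₁ ∪ F₂, I₁, hp.join_lt hd hadj (.singletons G F₂) hlt,
    Finset.union_subset_union hW₁ subset_rfl, hI₁.trans Finset.subset_union_left, ?_, ?_, ?_⟩
  · exact Finset.disjoint_union_right.2 ⟨hd₁, hd.mono_left hI₁⟩
  · have := Finset.card_union_le W₁ F₂
    omega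
  · intro i hi j hj hij h
    refine hconn₁ i hi j hj hij (h.mono ?_)
    rintro v ⟨hv, hv'⟩
    simp only [Finset.mem_union, not_or] at hv hv'
    exact ⟨hv.resolve_right hv'.2, hv'.1⟩

lemma join (hd : Disjoint F₁ F₂) (hadj : ∀ a ∈ F₁, ∀ b ∈ F₂, G.Adj a b) (hne : F₁.Nonempty)
    (hne₂ : F₂.Nonempty)
    (h₁ : ScatteredCover G F₁) (h₂ : ScatteredCover G F₂) : ScatteredCover G (F₁ ∪ F₂) := by
  obtain ⟨p, W₁, I₁, hp, hW₁, hI₁, hd₁, hc₁, hconn₁⟩ := h₁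
  obtain ⟨q, W₂, I₂, hq, hW₂, hI₂, hd₂, hc₂, hconn₂⟩ := h₂
  rcases lt_or_ge F₂.card p with hlt | hp'
  · exact join_of_lt hd hadj hp hW₁ hI₁ hd₁ hc₁ hconn₁ hlt
  rcases lt_or_ge F₁.card q with hlt | hq'
  · rw [Finset.union_comm]
    exact join_of_lt hd.symm (fun a ha b hb => (hadj b hb a ha).symm) hq hW₂ hI₂ hd₂ hc₂ hconn₂ hlt
  have h1 := hp.le_card
  have h2 := hq.le_card
  have h3 := hne.card_pos
  have h4 := hne₂.card_pos
  obtain ⟨v, hv⟩ := hne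
  refine ⟨1, ∅, {v}, ?_, by simp, by simp [hv], by simp, by simp, ?_⟩
  · exact PathCover.join_eq (p := max 1 (max p q)) hd hadj (hp.mono (by omega) (by omega))
      (hq.mono (by omega) (by omega)) (by omega)
  · simp +contextual

end ScatteredCover

lemma NoP4On.scatteredCover {F : Finset V} (h : NoP4On G (F : Set V)) : ScatteredCover G F := by
  classical
  induction hn : F.card using Nat.strong_induction_on generalizing F with
  | _ n ih =>
    rcases lt_or_ge F.card 2 with hF | hF
    · refine ⟨F.card, ∅, F, .singletons G F, by simp, subset_rfl, by simp, by simp, ?_⟩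
      exact fun i hi j hj hij => (hij (Finset.card_le_one.1 (by omega) i hi j hj)).elim
    have hsplit : ∀ {H : SimpleGraph V}, Separates H (F : Set V) → ∃ F₁ F₂ : Finset V,
        F₁.Nonempty ∧ F₂.Nonempty ∧ Disjoint F₁ F₂ ∧ F₁ ∪ F₂ = F ∧
        (∀ a ∈ F₁, ∀ b ∈ F₂, ¬ H.Adj a b) ∧ ScatteredCover G F₁ ∧ ScatteredCover G F₂ := by
      rintro H ⟨A, hA, ⟨a, ha⟩, ⟨b, hb⟩, hAB⟩
      refine ⟨F.filter (· ∈ A), F.filter (· ∉ A), ⟨a, by simpa [ha] using hA ha⟩, ⟨b, by simpa using hb⟩,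
        Finset.disjoint_filter_filter_not _ _ _, Finset.filter_union_filter_not_eq _ _, ?_, ?_, ?_⟩
      · intro a ha b hb
        exact hAB a (by simp_all) b (by simp_all)
      · refine ih _ ?_ (h.mono (Finset.coe_subset.2 (Finset.filter_subset _ _))) rfl
        rw [← hn]
        exact Finset.card_lt_card (Finset.filter_ssubset.2 ⟨b, hb.1, hb.2⟩)
      · refine ih _ ?_ (h.mono (Finset.coe_subset.2 (Finset.filter_subset _ _))) rfl
        rw [← hn]
        exact Finset.card_lt_card (Finset.filter_ssubset.2 ⟨a, hA ha, not_not.2 ha⟩)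
    rcases h.separates_or F hF with hs | hs
    · obtain ⟨F₁, F₂, -, -, hd, rfl, hadj, h₁, h₂⟩ := hsplit hs
      exact h₁.union hd hadj h₂
    · obtain ⟨F₁, F₂, hne₁, hne₂, hd, rfl, hadj, h₁, h₂⟩ := hsplit hs
      refine h₁.join hd (fun a ha b hb => ?_) hne₁ hne₂ h₂
      by_contra hab
      exact hadj a ha b hb ⟨fun h => Finset.disjoint_left.1 hd ha (h ▸ hb), hab⟩

/-- The cyclic list `c` has no repetitions and its cyclically consecutive members are adjacent. -/
def IsCyclicPath (G : SimpleGraph V) (c : List V) : Prop :=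
  c.Nodup ∧ Cycle.Chain G.Adj (c : Cycle V)

namespace IsCyclicPath

variable {c c' : List V}

lemma rotate (h : IsCyclicPath G c) (hr : c ~r c') : IsCyclicPath G c' :=
  ⟨hr.nodup_iff.1 h.1, (Cycle.coe_eq_coe.2 hr) ▸ h.2⟩

lemma isChain_concat {a : V} {l : List V} (h : IsCyclicPath G (a :: l)) :
    (a :: l ++ [a]).IsChain G.Adj := by
  simpa using h.2

lemma isChain (h : IsCyclicPath G c) : c.IsChain G.Adj := by
  cases c with
  | nil => simp
  | cons a l => exact (List.isChain_append.1 h.isChain_concat).1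

lemma reverse (h : IsCyclicPath G c) : IsCyclicPath G c.reverse := by
  cases c with
  | nil => exact h
  | cons a l =>
    have : IsCyclicPath G (a :: l.reverse) := by
      refine ⟨by simpa using h.1, ?_⟩
      have := h.isChain_concat
      rw [← List.isChain_reverse] at this
      simpa [flip, G.adj_comm] using this
    refine this.rotate ?_
    simpa using (List.isRotated_concat a l.reverse).symm

lemma of_isChain (hn : c.Nodup) (h : c.IsChain G.Adj)
    (hlast : ∀ u ∈ c.getLast?, ∀ v ∈ c.head?, G.Adj u v) : IsCyclicPath G c := by
  refine ⟨hn, ?_⟩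
  cases c with
  | nil => simp
  | cons a l =>
    rw [Cycle.chain_coe_cons, ← List.cons_append, List.isChain_append]
    exact ⟨h, by simp, by simpa using hlast⟩

end IsCyclicPath

lemma List.IsChain.of_isInfix {α : Type*} {R : α → α → Prop} {l l' : List α} (h : l.IsChain R)
    (hl : l' <:+: l) : l'.IsChain R := by
  obtain ⟨s, t, rfl⟩ := hl
  exact (List.isChain_append.1 (List.isChain_append.1 h).1).2.1

lemma List.exists_isRotated_cons {α : Type*} {c : List α} {x : α} (h : x ∈ c) :
    ∃ l, c ~r x :: l := by
  obtain ⟨s, t, rfl⟩ := List.append_of_mem h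
  exact ⟨t ++ s, by simpa using List.isRotated_append (l := s) (l' := x :: t)⟩

lemma List.IsRotated.isChain_formPerm [DecidableEq V] {c l : List V} (hc : c.Nodup) (h : c ~r l) :
    l.IsChain fun a b => c.formPerm a = b := by
  rw [List.isChain_iff_forall_rel_of_append_cons_cons]
  rintro a b s t rfl
  have h2 := h.trans List.isRotated_append
  rw [List.formPerm_eq_of_isRotated hc h2]
  exact List.formPerm_apply_head a b _ (h2.nodup_iff.1 hc)

lemma List.IsRotated.exists_cons_cons [DecidableEq V] {c l : List V} (hc : c.Nodup) (h : c ~r l) {x : V}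
    (hx : x ∈ c) (hlast : x ∉ l.getLast?) : ∃ s t, l = s ++ x :: c.formPerm x :: t := by
  obtain ⟨s, t, rfl⟩ := List.append_of_mem (h.mem_iff.1 hx)
  cases t with
  | nil => simp at hlast
  | cons b t =>
    have := List.isChain_iff_forall_rel_of_append_cons_cons.1 (h.isChain_formPerm hc) rfl
    exact ⟨s, t, by rw [this]⟩

lemma List.Nodup.append_cons_inj {α : Type*} {x : α} {s s' t t' : List α}
    (h : (s ++ x :: t).Nodup) (e : s ++ x :: t = s' ++ x :: t') : s = s' ∧ t = t' := by
  induction s generalizing s' with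
  | nil =>
    cases s' with
    | nil => simpa using e
    | cons a s' =>
      simp only [List.nil_append, List.cons_append, List.cons.injEq] at e
      simp [e.2] at h
  | cons a s ih =>
    cases s' with
    | nil =>
      simp only [List.nil_append, List.cons_append, List.cons.injEq] at e
      simp [e.1] at h
    | cons b s' =>
      simp only [List.cons_append, List.cons.injEq] at e
      simp only [List.cons_append, List.nodup_cons] at h
      have := ih h.2 e.2
      simp [e.1, this]

/-- `c` is a longest cycle and `N` the set of attachments on `c` of a connected set `B` of vertices
off `c`. -/
structure LongestCycle (G : SimpleGraph V) (c : List V) (B : Set V) (N : Finset V) : Prop where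
  isCyclicPath : IsCyclicPath G c
  length_le : ∀ c', IsCyclicPath G c' → c'.length ≤ c.length
  notMem : ∀ b ∈ B, b ∉ c
  attach_mem : ∀ x ∈ N, x ∈ c
  link : ∀ x ∈ N, ∀ x' ∈ N, ∃ l : List V, l ≠ [] ∧ l.Nodup ∧ l.IsChain G.Adj ∧ (∀ v ∈ l, v ∈ B) ∧
    (∀ u ∈ l.head?, G.Adj x u) ∧ ∀ u ∈ l.getLast?, G.Adj u x'
  closed : ∀ b ∈ B, ∀ v, G.Adj b v → v ∈ B ∨ v ∈ N

namespace LongestCycle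

variable {c c' : List V} {B : Set V} {N : Finset V}

lemma rotate (h : LongestCycle G c B N) (hr : c ~r c') : LongestCycle G c' B N where
  isCyclicPath := h.isCyclicPath.rotate hr
  length_le := hr.perm.length_eq ▸ h.length_le
  notMem b hb hbc := h.notMem b hb (hr.mem_iff.2 hbc)
  attach_mem x hx := hr.mem_iff.1 (h.attach_mem x hx)
  link := h.link
  closed := h.closed

lemma reverse (h : LongestCycle G c B N) : LongestCycle G c.reverse B N where
  isCyclicPath := h.isCyclicPath.reverse
  length_le := by simpa using h.length_le
  notMem b hb hbc := h.notMem b hb (by simpa using hbc)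
  attach_mem x hx := by simpa using h.attach_mem x hx
  link := h.link
  closed := h.closed

lemma nodup (h : LongestCycle G c B N) : c.Nodup := h.isCyclicPath.1

lemma length_lt (h : LongestCycle G c B N) {Q : List V} (hn : Q.Nodup) (hQ : Q.IsChain G.Adj)
    (hB : ∀ v ∈ Q, v ∉ B) {x x' : V} (hx : x ∈ N) (hx' : x' ∈ N) (hhead : x' ∈ Q.head?)
    (hlast : x ∈ Q.getLast?) : Q.length < c.length := by
  obtain ⟨l, hne, hln, hlc, hlB, hlh, hll⟩ := h.link x hx x' hx'
  have := h.length_le (Q ++ l) (.of_isChain ?_ ?_ ?_)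
  · have := List.length_pos_iff.2 hne
    simp at *
    omega
  · exact List.nodup_append.2 ⟨hn, hln, by rintro a ha _ hb rfl; exact hB a ha (hlB a hb)⟩
  · refine List.isChain_append.2 ⟨hQ, hlc, fun u hu v hv => ?_⟩
    rw [Option.mem_unique hu hlast]
    exact hlh v hv
  · intro u hu v hv
    rw [List.getLast?_append_of_ne_nil _ hne] at hu
    rw [List.head?_append_of_ne_nil _ (by rintro rfl; simp at hhead)] at hv
    rw [Option.mem_unique hv hhead]
    exact hll u hu

private lemma false_of_split (h : LongestCycle G c B N) {Q P₁ P₂ P₃ : List V} {x₁ a₁ x₂ a₂ y y' : V}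
    (hQ : Q = P₁ ++ x₁ :: a₁ :: P₂ ++ x₂ :: a₂ :: P₃) (hn : Q.Nodup) (hch : Q.IsChain G.Adj)
    (hB : ∀ v ∈ Q, v ∉ B) (hlen : c.length ≤ Q.length) (hhead : y' ∈ Q.head?)
    (hlast : y ∈ Q.getLast?) (hx₁ : x₁ ∈ N) (hx₂ : x₂ ∈ N) (hy : G.Adj y a₁) (hy' : G.Adj y' a₂) :
    False := by
  have hperm : ((a₁ :: P₂ ++ [x₂]).reverse ++ ((a₂ :: P₃).reverse ++ (P₁ ++ [x₁]))).Perm Q := by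
    rw [← Multiset.coe_eq_coe]
    simp only [hQ, ← Multiset.coe_add, ← Multiset.cons_coe, Multiset.coe_reverse,
      List.cons_append, ← Multiset.singleton_add, Multiset.coe_nil]
    abel
  refine (h.length_lt (hperm.nodup_iff.2 hn) ?_ (fun v hv => hB v (hperm.mem_iff.1 hv))
    hx₁ hx₂ (by simp)
    (by simp [List.getLast?_append, List.getLast?_cons])).not_ge (hperm.length_eq ▸ hlen)
  have e₁ : (a₁ :: P₂ ++ [x₂]).IsChain G.Adj :=
    hch.of_isInfix ⟨P₁ ++ [x₁], a₂ :: P₃, by simp [hQ]⟩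
  have e₂ : (a₂ :: P₃).IsChain G.Adj := hch.of_isInfix ⟨P₁ ++ x₁ :: a₁ :: P₂ ++ [x₂], [], by simp [hQ]⟩
  have e₃ : (P₁ ++ [x₁]).IsChain G.Adj := hch.of_isInfix ⟨[], a₁ :: P₂ ++ x₂ :: a₂ :: P₃, by simp [hQ]⟩
  rw [List.isChain_append, List.isChain_append, List.isChain_reverse, List.isChain_reverse]
  refine ⟨by simpa [flip, G.adj_comm] using e₁, ⟨by simpa [flip, G.adj_comm] using e₂, e₃, ?_⟩, ?_⟩
  · intro u hu v hv
    obtain rfl : u = a₂ := by simpa [eq_comm] using hu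
    have : v ∈ Q.head? := by
      rw [hQ]
      cases P₁ with
      | nil => simpa using hv
      | cons p P₁ => simpa using hv
    rw [Option.mem_unique this hhead]
    exact hy'.symm
  · intro u hu v hv
    obtain rfl : u = a₁ := by
      rw [List.getLast?_reverse] at hu
      simpa [eq_comm] using hu
    have : v ∈ Q.getLast? := by
      rw [hQ, List.getLast?_append_of_ne_nil _ (by simp)]
      rw [List.head?_append_of_ne_nil _ (by simp), List.head?_reverse] at hv
      simpa [List.getLast?_cons] using hv
    rw [Option.mem_unique this hlast]
    exact hy.symm

/-- A path at least as long as `c` that avoids `B` and keeps two attachments together with their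
successors cannot have both ends adjacent to both of these successors. -/
lemma false_of_path (h : LongestCycle G c B N) {Q : List V} {x₁ a₁ x₂ a₂ y y' : V}
    (hn : Q.Nodup) (hch : Q.IsChain G.Adj)
    (hB : ∀ v ∈ Q, v ∉ B) (hlen : c.length ≤ Q.length) (hhead : y' ∈ Q.head?)
    (hlast : y ∈ Q.getLast?) (hx₁ : x₁ ∈ N) (hx₂ : x₂ ∈ N) (ha₁ : a₁ ∉ N) (ha₂ : a₂ ∉ N)
    (hne : x₁ ≠ x₂) (h₁ : ∃ s t, Q = s ++ x₁ :: a₁ :: t) (h₂ : ∃ s t, Q = s ++ x₂ :: a₂ :: t)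
    (hy₁ : G.Adj y a₁) (hy₂ : G.Adj y a₂) (hy₁' : G.Adj y' a₁) (hy₂' : G.Adj y' a₂) : False := by
  obtain ⟨s, t, hst⟩ := h₁
  obtain ⟨s', t', hst'⟩ := h₂
  have hmem : x₂ ∈ s ++ x₁ :: a₁ :: t := by rw [← hst, hst']; simp
  simp only [List.mem_append, List.mem_cons] at hmem
  rcases hmem with hm | hm | hm | hm
  · obtain ⟨P, P', rfl⟩ := List.append_of_mem hm
    have e : s' ++ x₂ :: a₂ :: t' = P ++ x₂ :: (P' ++ x₁ :: a₁ :: t) := by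
      rw [← hst', hst]; simp
    have := (List.Nodup.append_cons_inj (hst' ▸ hn) e).2
    cases P' with
    | nil =>
      simp only [List.nil_append, List.cons.injEq] at this
      exact ha₂ (this.1 ▸ hx₁)
    | cons b P' =>
      simp only [List.cons_append, List.cons.injEq] at this
      obtain ⟨rfl, rfl⟩ := this
      exact h.false_of_split (P₁ := s') (P₂ := P') (P₃ := t) (by rw [hst']; simp) hn hch hB hlen
        hhead hlast hx₂ hx₁ hy₂ hy₁'
  · exact hne hm.symm
  · exact ha₁ (hm ▸ hx₂)
  · obtain ⟨P, P', rfl⟩ := List.append_of_mem hm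
    have e : s' ++ x₂ :: a₂ :: t' = (s ++ x₁ :: a₁ :: P) ++ x₂ :: P' := by
      rw [← hst', hst]; simp
    obtain ⟨rfl, rfl⟩ := List.Nodup.append_cons_inj (hst' ▸ hn) e
    exact h.false_of_split (P₁ := s) (P₂ := P) (P₃ := t') (by rw [hst']) hn hch hB hlen
      hhead hlast hx₁ hx₂ hy₁ hy₂'

variable [DecidableEq V]

lemma next_notMem (h : LongestCycle G c B N) {x : V} (hx : x ∈ N) : c.formPerm x ∉ N := by
  intro ha
  obtain ⟨l, hl⟩ := List.exists_isRotated_cons (h.attach_mem x hx)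
  have hr : c ~r l ++ [x] := hl.trans (List.isRotated_concat x l).symm
  have hQ := h.rotate hr
  refine (h.length_lt hQ.nodup hQ.isCyclicPath.isChain
    (fun v hv hvB => hQ.notMem v hvB hv) hx ha ?_ (by simp)).ne hr.perm.length_eq.symm
  rw [List.formPerm_eq_of_isRotated h.nodup hl]
  cases l with
  | nil => simp
  | cons b l =>
    rw [List.formPerm_apply_head _ _ _ (hl.nodup_iff.1 h.nodup)]
    simp

/-- The cycle can be written from one attachment so that a second one shows up with its successor. -/
lemma exists_isRotated (h : LongestCycle G c B N) {x x' : V} (hx : x ∈ N) (hx' : x' ∈ N)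
    (hne : x ≠ x') :
    ∃ l₁ l₂, c ~r x :: c.formPerm x :: l₁ ++ x' :: c.formPerm x' :: l₂ := by
  obtain ⟨l, hl⟩ := List.exists_isRotated_cons (h.attach_mem x hx)
  have hx'l : x' ∈ l := by
    simpa [hne.symm] using hl.mem_iff.1 (h.attach_mem x' hx')
  have hch := hl.isChain_formPerm h.nodup
  obtain ⟨b, l, rfl⟩ := List.exists_cons_of_ne_nil (List.ne_nil_of_mem hx'l)
  have hb : c.formPerm x = b := (List.isChain_cons_cons.1 hch).1
  obtain ⟨l₁, l₂, rfl⟩ : ∃ l₁ l₂, l = l₁ ++ x' :: l₂ := by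
    refine List.append_of_mem ((List.mem_cons.1 hx'l).resolve_left ?_)
    rintro rfl
    exact h.next_notMem hx (hb ▸ hx')
  cases l₂ with
  | nil =>
    have h2 : c ~r x' :: x :: b :: l₁ :=
      hl.trans (by simpa using List.isRotated_concat x' (x :: b :: l₁))
    have := (List.isChain_cons_cons.1 (h2.isChain_formPerm h.nodup)).1
    exact (h.next_notMem hx' (this ▸ hx)).elim
  | cons d l₂ =>
    have : c.formPerm x' = d := List.isChain_iff_forall_rel_of_append_cons_cons.1 hch
      (show x :: b :: (l₁ ++ x' :: d :: l₂) = (x :: b :: l₁) ++ x' :: d :: l₂ by simp)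
    exact ⟨l₁, l₂, by simpa [this, hb] using hl⟩

/-- Successors of distinct attachments are not joined by a path off the cycle and off `B`. -/
lemma false_of_isChain (h : LongestCycle G c B N) {x x' : V} (hx : x ∈ N) (hx' : x' ∈ N)
    (hne : x ≠ x') {m : List V} (hm : m.Nodup) (hmc : ∀ v ∈ m, v ∉ c) (hmB : ∀ v ∈ m, v ∉ B)
    (hchain : (c.formPerm x' :: m ++ [c.formPerm x]).IsChain G.Adj) : False := by
  obtain ⟨l₁, l₂, hr⟩ := h.exists_isRotated hx hx' hne
  set a := c.formPerm x
  set a' := c.formPerm x'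
  have hr' := h.rotate hr
  have hperm : (((a' :: l₂ ++ [x]).reverse ++ (m ++ (a :: l₁ ++ [x']))) : List V).Perm (m ++ c) := by
    have := Multiset.coe_eq_coe.2 hr.perm
    rw [← Multiset.coe_eq_coe]
    simp only [← Multiset.coe_add, ← Multiset.cons_coe, Multiset.coe_reverse,
      List.cons_append, this, ← Multiset.singleton_add, Multiset.coe_nil]
    abel
  have hlt := h.length_lt (Q := (a' :: l₂ ++ [x]).reverse ++ (m ++ (a :: l₁ ++ [x']))) ?_ ?_ ?_
    hx' hx (by simp) (by simp [List.getLast?_append, List.getLast?_cons])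
  · have := hperm.length_eq
    rw [List.length_append (as := m)] at this
    omega
  · rw [hperm.nodup_iff, List.nodup_append]
    exact ⟨hm, h.nodup, by rintro v hv _ hv' rfl; exact hmc v hv hv'⟩
  · have h1 := hr'.isCyclicPath.isChain_concat
    have h2 : (a' :: l₂ ++ [x]).IsChain G.Adj := by
      refine h1.of_isInfix ⟨x :: a :: l₁ ++ [x'], [], by simp⟩
    have h3 : (a :: l₁ ++ [x']).IsChain G.Adj := by
      refine h1.of_isInfix ⟨[x], a' :: l₂ ++ [x], by simp⟩
    have h4 : (m ++ [a]).IsChain G.Adj := hchain.tail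
    have h5 : (m ++ (a :: l₁ ++ [x'])).IsChain G.Adj := by
      rw [List.isChain_append] at h4 ⊢
      exact ⟨h4.1, h3, by simpa using h4.2.2⟩
    rw [List.isChain_append, List.isChain_reverse]
    refine ⟨by simpa [flip, G.adj_comm] using h2, h5, ?_⟩
    intro u hu v hv
    have hu : u = a' := by
      rw [List.getLast?_reverse] at hu
      simpa [eq_comm] using hu
    subst hu
    cases m with
    | nil =>
      obtain rfl : a = v := by simpa using hv
      simpa using hchain
    | cons w m =>
      obtain rfl : w = v := by simpa using hv
      simp only [List.cons_append, List.isChain_cons_cons] at hchain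
      exact hchain.1
  · intro v hv hvB
    rw [hperm.mem_iff, List.mem_append] at hv
    rcases hv with hv | hv
    exacts [hmB v hv hvB, h.notMem v hvB hv]

lemma not_adj_next (h : LongestCycle G c B N) {x x' : V} (hx : x ∈ N) (hx' : x' ∈ N) :
    ¬ G.Adj (c.formPerm x) (c.formPerm x') := by
  intro hadj
  refine h.false_of_isChain (m := []) hx' hx ?_ (by simp) (by simp) (by simp) (by simpa using hadj)
  rintro rfl
  exact G.irrefl hadj

lemma mem_of_adj_next (h : LongestCycle G c B N) {x x' v : V} (hx : x ∈ N) (hx' : x' ∈ N)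
    (hne : x ≠ x') (hv : v ∉ B) (h₁ : G.Adj v (c.formPerm x)) (h₂ : G.Adj v (c.formPerm x')) :
    v ∈ c := by
  by_contra hvc
  exact h.false_of_isChain (m := [v]) hx hx' hne (by simp) (by simpa) (by simpa)
    (by simpa using ⟨h₂.symm, h₁⟩)

end LongestCycle

lemma NoP4On.exists_common_neighbor {X : Set V} (h : NoP4On G X) {u v : V} (huv : ConnIn G X u v)
    (hne : u ≠ v) (hadj : ¬ G.Adj u v) : ∃ w ∈ X, G.Adj u w ∧ G.Adj w v := by
  refine ((huv.closed (D := {z | z = u ∨ G.Adj u z ∨ ∃ w ∈ X, G.Adj u w ∧ G.Adj w z}) ?_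
    (Or.inl rfl)).resolve_left hne.symm).resolve_left hadj
  rintro a ha b hb haX hab
  rcases ha with rfl | ha | ⟨w, hw, huw, hwa⟩
  · exact Or.inr (Or.inl hab)
  · exact Or.inr (Or.inr ⟨a, haX, ha, hab⟩)
  by_cases hbu : b = u
  · exact Or.inl hbu
  by_cases hau : u = a
  · exact Or.inr (Or.inl (hau ▸ hab))
  by_cases hwb : w = b
  · exact Or.inr (Or.inl (hwb ▸ huw))
  rcases h u huv.left_mem w hw a haX b hb huw hwa hab hau (Ne.symm hbu) hwb with h | h | h
  · exact Or.inr (Or.inr ⟨a, haX, h, hab⟩)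
  · exact Or.inr (Or.inl h)
  · exact Or.inr (Or.inr ⟨w, hw, huw, h⟩)

/-- A longest cycle `c` with an off-cycle set `B` attached to it at `N`; the sets `A` and `P` consist
of the successors and the predecessors of the attachments, and `Y` of the vertices outside `N` with
at least two neighbours in `A`. -/
structure CycleFrame [DecidableEq V] (G : SimpleGraph V) (c : List V) (B : Set V)
    (N A P Y : Finset V) : Prop extends LongestCycle G c B N where
  free : P4P1Free G
  nonempty : B.Nonempty
  mem_succ : ∀ v, v ∈ A ↔ ∃ x ∈ N, c.formPerm x = v
  mem_pred : ∀ v, v ∈ P ↔ c.formPerm v ∈ N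
  mem_multi : ∀ v, v ∈ Y ↔ v ∉ N ∧ ∃ a ∈ A, ∃ a' ∈ A, a ≠ a' ∧ G.Adj v a ∧ G.Adj v a'

/-- The vertices outside `N`, `B` and `Y`. -/
def remainder (B : Set V) (N Y : Finset V) : Set V := {v | v ∉ N ∧ v ∉ B ∧ v ∉ Y}

namespace CycleFrame

variable [DecidableEq V] {c : List V} {B : Set V} {N A P Y : Finset V}

lemma succ_mem (h : CycleFrame G c B N A P Y) {v : V} (hv : v ∈ A) : v ∈ c := by
  obtain ⟨x, hx, rfl⟩ := (h.mem_succ v).1 hv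
  exact List.formPerm_apply_mem_of_mem (h.attach_mem x hx)

lemma succ_notMem_attach (h : CycleFrame G c B N A P Y) {v : V} (hv : v ∈ A) : v ∉ N := by
  obtain ⟨x, hx, rfl⟩ := (h.mem_succ v).1 hv
  exact h.next_notMem hx

lemma succ_notMem (h : CycleFrame G c B N A P Y) {v : V} (hv : v ∈ A) : v ∉ B :=
  fun hvB => h.notMem v hvB (h.succ_mem hv)

lemma succ_indep (h : CycleFrame G c B N A P Y) {v w : V} (hv : v ∈ A) (hw : w ∈ A) :
    ¬ G.Adj v w := by
  obtain ⟨x, hx, rfl⟩ := (h.mem_succ v).1 hv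
  obtain ⟨x', hx', rfl⟩ := (h.mem_succ w).1 hw
  exact h.not_adj_next hx hx'

lemma pred_mem (h : CycleFrame G c B N A P Y) {v : V} (hv : v ∈ P) : v ∈ c :=
  List.mem_of_formPerm_apply_mem (h.attach_mem _ ((h.mem_pred v).1 hv))

lemma pred_notMem_attach (h : CycleFrame G c B N A P Y) {v : V} (hv : v ∈ P) : v ∉ N :=
  fun hvN => h.next_notMem hvN ((h.mem_pred v).1 hv)

lemma pred_indep (h : CycleFrame G c B N A P Y) {v w : V} (hv : v ∈ P) (hw : w ∈ P) :
    ¬ G.Adj v w := by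
  have := h.reverse.not_adj_next ((h.mem_pred v).1 hv) ((h.mem_pred w).1 hw)
  simpa [List.formPerm_reverse] using this

lemma card_succ (h : CycleFrame G c B N A P Y) : A.card = N.card := by
  have : A = N.image c.formPerm := by
    ext v
    simp [h.mem_succ]
  rw [this, Finset.card_image_of_injective _ c.formPerm.injective]

lemma card_pred_le (h : CycleFrame G c B N A P Y) : P.card ≤ N.card :=
  Finset.card_le_card_of_injOn c.formPerm (fun v hv => (h.mem_pred v).1 hv)
    c.formPerm.injective.injOn

lemma multi_notMem (h : CycleFrame G c B N A P Y) {v : V} (hv : v ∈ Y) : v ∉ B := by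
  intro hvB
  obtain ⟨-, a, ha, -, -, -, hva, -⟩ := (h.mem_multi v).1 hv
  rcases h.closed v hvB a hva with h' | h'
  exacts [h.succ_notMem ha h', h.succ_notMem_attach ha h']

lemma multi_notMem_attach (h : CycleFrame G c B N A P Y) {v : V} (hv : v ∈ Y) : v ∉ N :=
  ((h.mem_multi v).1 hv).1

lemma multi_mem (h : CycleFrame G c B N A P Y) {v : V} (hv : v ∈ Y) : v ∈ c := by
  obtain ⟨-, a, ha, a', ha', hne, hva, hva'⟩ := (h.mem_multi v).1 hv
  obtain ⟨x, hx, rfl⟩ := (h.mem_succ a).1 ha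
  obtain ⟨x', hx', rfl⟩ := (h.mem_succ a').1 ha'
  exact h.mem_of_adj_next hx hx' (fun e => hne (by rw [e])) (h.multi_notMem hv) hva hva'

lemma succ_notMem_multi (h : CycleFrame G c B N A P Y) {v : V} (hv : v ∈ A) : v ∉ Y := by
  intro hvY
  obtain ⟨-, a, ha, -, -, -, hva, -⟩ := (h.mem_multi v).1 hvY
  exact h.succ_indep hv ha hva

lemma succ_mem_remainder (h : CycleFrame G c B N A P Y) {v : V} (hv : v ∈ A) :
    v ∈ remainder B N Y :=
  ⟨h.succ_notMem_attach hv, h.succ_notMem hv, h.succ_notMem_multi hv⟩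

lemma noP4On (h : CycleFrame G c B N A P Y) : NoP4On G {v | v ∉ N ∧ v ∉ B} := by
  intro u hu v hv w hw z hz huv hvw hwz huw huz hvz
  by_contra! hcon
  obtain ⟨b, hb⟩ := h.nonempty
  have hne : ∀ {v : V}, v ∉ N ∧ v ∉ B → b ≠ v := by rintro v hv rfl; exact hv.2 hb
  have hadj : ∀ {v : V}, v ∉ N ∧ v ∉ B → ¬ G.Adj b v :=
    fun hv hbv => (h.closed b hb _ hbv).elim hv.2 hv.1
  exact h.free.false_of_adj huv hvw hwz hcon.1 hcon.2.1 hcon.2.2 huw huz hvz (hne hu) (hne hv)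
    (hne hw) (hne hz) (hadj hu) (hadj hv) (hadj hw) (hadj hz)

lemma noP4On_remainder (h : CycleFrame G c B N A P Y) : NoP4On G (remainder B N Y) :=
  h.noP4On.mono fun _ hv => ⟨hv.1, hv.2.1⟩

lemma eq_of_connIn (h : CycleFrame G c B N A P Y) {a a' : V} (ha : a ∈ A) (ha' : a' ∈ A)
    (hconn : ConnIn G (remainder B N Y) a a') : a = a' := by
  by_contra hne
  obtain ⟨w, hw, haw, hwa⟩ :=
    h.noP4On_remainder.exists_common_neighbor hconn hne (h.succ_indep ha ha')
  exact hw.2.2 ((h.mem_multi w).2 ⟨hw.1, a, ha, a', ha', hne, haw.symm, hwa⟩)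

lemma adj_of_connIn (h : CycleFrame G c B N A P Y) {y u v : V} (hy : y ∈ Y) (hyu : G.Adj y u)
    (hconn : ConnIn G (remainder B N Y) u v) : G.Adj y v := by
  by_contra hyv
  obtain ⟨w, w', hw, hw', hwX, hwX', hww', huw⟩ :=
    hconn.exists_crossing (D := {z | G.Adj y z}) hyu hyv
  obtain ⟨a, ha, hya, hau⟩ : ∃ a ∈ A, G.Adj y a ∧ ¬ ConnIn G (remainder B N Y) u a := by
    obtain ⟨-, a, ha, a', ha', hne, hya, hya'⟩ := (h.mem_multi y).1 hy
    by_cases hua : ConnIn G (remainder B N Y) u a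
    · exact ⟨a', ha', hya', fun hua' => hne (h.eq_of_connIn ha ha' (hua.symm.trans hua'))⟩
    · exact ⟨a, ha, hya, hua⟩
  have huw' := huw.trans (.of_adj hwX hwX' hww')
  have haX := h.succ_mem_remainder ha
  have haw : ∀ {z}, ConnIn G (remainder B N Y) u z → ¬ G.Adj a z :=
    fun hz haz => hau (hz.trans (.of_adj hz.right_mem haX haz.symm))
  have haz : ∀ {z}, ConnIn G (remainder B N Y) u z → a ≠ z := by rintro z hz rfl; exact hau hz
  rcases h.noP4On a ⟨haX.1, haX.2.1⟩ y ⟨h.multi_notMem_attach hy, h.multi_notMem hy⟩ w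
    ⟨hwX.1, hwX.2.1⟩ w' ⟨hwX'.1, hwX'.2.1⟩ hya.symm hw hww' (haz huw) (haz huw')
    (by rintro rfl; exact hwX'.2.2 hy) with h' | h' | h'
  exacts [haw huw h', haw huw' h', hw' h']

lemma exists_common_succ (h : CycleFrame G c B N A P Y) {y y' : V} (hy : y ∈ Y) (hy' : y' ∈ Y)
    (hyy' : y = y' ∨ G.Adj y y' ∨ ∃ w ∈ remainder B N Y, G.Adj y w ∧ G.Adj y' w) :
    ∃ a ∈ A, ∃ a' ∈ A, a ≠ a' ∧ G.Adj y a ∧ G.Adj y a' ∧ G.Adj y' a ∧ G.Adj y' a' := by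
  have hR : ∀ {v}, v ∈ Y → v ∉ N ∧ v ∉ B := fun hv => ⟨h.multi_notMem_attach hv, h.multi_notMem hv⟩
  have hA : ∀ {v}, v ∈ A → v ∉ N ∧ v ∉ B := fun hv => ⟨h.succ_notMem_attach hv, h.succ_notMem hv⟩
  have key : (∀ a ∈ A, G.Adj y a → G.Adj y' a) ∨ (∀ a ∈ A, G.Adj y' a → G.Adj y a) := by
    by_contra! hcon
    obtain ⟨⟨a, ha, hya, hya'⟩, a', ha', hya₂, hya₂'⟩ := hcon
    have hne : y ≠ y' := by rintro rfl; exact hya' hya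
    by_cases hadj : G.Adj y y'
    · rcases h.noP4On a (hA ha) y (hR hy) y' (hR hy') a' (hA ha') hya.symm hadj hya₂
        (by rintro rfl; exact h.succ_notMem_multi ha hy') (by rintro rfl; exact hya' hya₂)
        (by rintro rfl; exact h.succ_notMem_multi ha' hy) with h' | h' | h'
      exacts [hya' h'.symm, h.succ_indep ha ha' h', hya₂' h']
    · obtain ⟨w, hw, hyw, hyw'⟩ := (hyy'.resolve_left hne).resolve_left hadj
      rcases h.noP4On a (hA ha) y (hR hy) w ⟨hw.1, hw.2.1⟩ y' (hR hy') hya.symm hyw hyw'.symm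
        (by rintro rfl; exact hya' hyw') (by rintro rfl; exact h.succ_notMem_multi ha hy') hne
        with h' | h' | h'
      · exact hya' (h.adj_of_connIn hy' hyw'
          (.of_adj hw (h.succ_mem_remainder ha) h'.symm))
      · exact hya' h'.symm
      · exact hadj h'
  rcases key with key | key
  · obtain ⟨-, a, ha, a', ha', hne, hya, hya'⟩ := (h.mem_multi y).1 hy
    exact ⟨a, ha, a', ha', hne, hya, hya', key a ha hya, key a' ha' hya'⟩
  · obtain ⟨-, a, ha, a', ha', hne, hya, hya'⟩ := (h.mem_multi y').1 hy'
    exact ⟨a, ha, a', ha', hne, key a ha hya, key a' ha' hya', hya, hya'⟩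

lemma false_of_multi_path (h : CycleFrame G c B N A P Y) {Q : List V} {y y' : V} (hn : Q.Nodup)
    (hch : Q.IsChain G.Adj) (hB : ∀ v ∈ Q, v ∉ B) (hlen : c.length ≤ Q.length)
    (hhead : y' ∈ Q.head?) (hlast : y ∈ Q.getLast?) (hy : y ∈ Y) (hy' : y' ∈ Y)
    (hyy' : y = y' ∨ G.Adj y y' ∨ ∃ w ∈ remainder B N Y, G.Adj y w ∧ G.Adj y' w)
    (hQ : ∀ x ∈ N, ∃ s t, Q = s ++ x :: c.formPerm x :: t) : False := by
  obtain ⟨a, ha, a', ha', hne, h₁, h₂, h₃, h₄⟩ := h.exists_common_succ hy hy' hyy'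
  obtain ⟨x, hx, rfl⟩ := (h.mem_succ a).1 ha
  obtain ⟨x', hx', rfl⟩ := (h.mem_succ a').1 ha'
  exact h.false_of_path hn hch hB hlen hhead hlast hx hx' (h.next_notMem hx) (h.next_notMem hx')
    (fun e => hne (by rw [e])) (hQ x hx) (hQ x' hx') h₁ h₂ h₃ h₄

lemma next_multi_notMem (h : CycleFrame G c B N A P Y) {y : V} (hy : y ∈ Y) :
    c.formPerm y ∉ Y := by
  intro hy'
  obtain ⟨l, hl⟩ := List.exists_isRotated_cons (h.multi_mem hy)
  have hr : c ~r l ++ [y] := hl.trans (List.isRotated_concat y l).symm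
  have hch := hl.isChain_formPerm h.nodup
  have hcyc := (h.isCyclicPath.rotate hl).isChain
  have hQ := h.rotate hr
  refine h.false_of_multi_path (y := y) (y' := c.formPerm y) hQ.nodup hQ.isCyclicPath.isChain
    (fun v hv hvB => hQ.notMem v hvB hv) hr.perm.length_eq.le ?_ (by simp) hy hy' ?_ ?_
  · cases l with
    | nil => simp [List.formPerm_eq_of_isRotated h.nodup hl]
    | cons b l => simp [(List.isChain_cons_cons.1 hch).1]
  · cases l with
    | nil => simp [List.formPerm_eq_of_isRotated h.nodup hl]
    | cons b l =>
      rw [(List.isChain_cons_cons.1 hch).1]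
      exact Or.inr (Or.inl (List.isChain_cons_cons.1 hcyc).1)
  · intro x hx
    refine hr.exists_cons_cons h.nodup (h.attach_mem x hx) ?_
    simp only [List.getLast?_append_cons, List.getLast?_singleton, Option.mem_def,
      Option.some.injEq]
    rintro rfl
    exact h.multi_notMem_attach hy hx

end CycleFrame

lemma List.exists_append_cons_of_not {α : Type*} {p : α → Prop} {l : List α}
    (h : ∃ v ∈ l, ¬ p v) : ∃ s q t, l = s ++ q :: t ∧ (∀ v ∈ s, p v) ∧ ¬ p q := by
  induction l with
  | nil => simp at h
  | cons a l ih =>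
    by_cases ha : p a
    · obtain ⟨s, q, t, rfl, hs, hq⟩ := ih (by simpa [ha] using h)
      exact ⟨a :: s, q, t, rfl, by simpa [ha] using hs, hq⟩
    · exact ⟨[], a, l, rfl, by simp, ha⟩

/-- Replacing each maximal run of `F` in a list by a filler attached to its predecessor. -/
def substRuns (F : Set V) [DecidablePred (· ∈ F)] (f : V → List V) (l : List V) : List V :=
  l.flatMap fun v => if v ∈ F then [] else v :: f v

lemma isChain_substRuns {R : V → V → Prop} {F : Set V} [DecidablePred (· ∈ F)] {f : V → List V}
    (r : List V) : ∀ (p : V) (T : List V), (∀ v ∈ T, v ∈ F) → p ∉ F →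
    (∀ s p' T' q t, p :: T ++ r = s ++ p' :: T' ++ q :: t → p' ∉ F → q ∉ F → (∀ v ∈ T', v ∈ F) →
      (p' :: f p' ++ [q]).IsChain R) →
    (∀ q ∈ (p :: T ++ r).getLast?, q ∉ F ∧ f q = []) →
    (substRuns F f (p :: T ++ r)).IsChain R := by
  induction r with
  | nil =>
    intro p T hT hp _ hlast
    rcases T.eq_nil_or_concat with rfl | ⟨T, q, rfl⟩
    · have := (hlast p (by simp)).2
      simp [substRuns, hp, this]
    · exact ((hlast q (by simp [List.getLast?_cons])).1 (hT q (by simp))).elim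
  | cons v r ih =>
    intro p T hT hp hseg hlast
    by_cases hv : v ∈ F
    · have e : p :: T ++ v :: r = p :: (T ++ [v]) ++ r := by simp
      rw [e] at hseg hlast ⊢
      exact ih p (T ++ [v]) (by simpa [or_imp, forall_and, hv] using hT) hp hseg hlast
    · have hT' : T.flatMap (fun v => if v ∈ F then [] else v :: f v) = [] := by
        simpa [List.flatMap_eq_nil_iff] using hT
      have e : substRuns F f (p :: T ++ v :: r) = (p :: f p) ++ substRuns F f (v :: [] ++ r) := by
        simp [substRuns, hp, hT']
      have hih := ih v [] (by simp) hv (fun s p' T' q t e => hseg (p :: T ++ s) p' T' q t (by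
        rw [List.append_assoc, List.append_assoc, ← List.append_assoc s, ← e]; simp))
        (fun q hq => hlast q (by rw [List.getLast?_append_of_ne_nil _ (by simp)]; exact hq))
      have hpv := hseg [] p T v r (by simp) hp hv hT
      rw [e, List.isChain_append]
      rw [List.isChain_append] at hpv
      refine ⟨hpv.1, hih, ?_⟩
      have : (substRuns F f (v :: [] ++ r)).head? = some v := by simp [substRuns, hv]
      rw [this]
      simpa using hpv.2.2

/-- `q` is the first vertex outside `E` that the permutation `σ` reaches after `p`. -/
def NextOutside (σ : Equiv.Perm V) (E : Set V) (p q : V) : Prop :=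
  q ∉ E ∧ ∃ k, (σ ^ (k + 1)) p = q ∧ ∀ j < k, (σ ^ (j + 1)) p ∈ E

namespace NextOutside

variable {σ : Equiv.Perm V} {E : Set V} {p p' q q' : V}

lemma of_isChain {T : List V} (h : (p :: T ++ [q]).IsChain fun a b => σ a = b)
    (hT : ∀ v ∈ T, v ∈ E) (hq : q ∉ E) : NextOutside σ E p q := by
  induction T generalizing p with
  | nil => exact ⟨hq, 0, by simpa using h, by simp⟩
  | cons v T ih =>
    simp only [List.cons_append, List.isChain_cons_cons] at h
    obtain ⟨rfl, h⟩ := h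
    obtain ⟨-, k, hk, hj⟩ := ih h fun w hw => hT w (by simp [hw])
    refine ⟨hq, k + 1, by rwa [pow_succ, Equiv.Perm.mul_apply], fun j hj' => ?_⟩
    cases j with
    | zero => exact hT _ (by simp)
    | succ j =>
      rw [pow_succ, Equiv.Perm.mul_apply]
      exact hj j (by omega)

lemma right_unique (h : NextOutside σ E p q) (h' : NextOutside σ E p q') : q = q' := by
  obtain ⟨hq, k, hk, hj⟩ := h
  obtain ⟨hq', k', hk', hj'⟩ := h'
  rcases lt_trichotomy k k' with hlt | rfl | hlt
  · exact (hq (hk ▸ hj' k hlt)).elim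
  · exact hk.symm.trans hk'
  · exact (hq' (hk' ▸ hj k' hlt)).elim

lemma left_unique (h : NextOutside σ E p q) (h' : NextOutside σ E p' q) (hp : p ∉ E)
    (hp' : p' ∉ E) : p = p' := by
  have key : ∀ {p p' k k'}, p ∉ E → k ≤ k' → (σ ^ (k + 1)) p = q → (σ ^ (k' + 1)) p' = q →
      (∀ j < k', (σ ^ (j + 1)) p' ∈ E) → p = p' := by
    intro p p' k k' hp hle hk hk' hj
    have e : p = (σ ^ (k' - k)) p' := by
      apply (σ ^ (k + 1)).injective
      rw [hk, ← Equiv.Perm.mul_apply, ← pow_add, ← hk']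
      congr 2
      omega
    rcases hle.eq_or_lt with rfl | hlt
    · simpa using e
    · refine (hp ?_).elim
      rw [e, show k' - k = (k' - k - 1) + 1 by omega]
      exact hj _ (by omega)
  obtain ⟨-, k, hk, hj⟩ := h
  obtain ⟨-, k', hk', hj'⟩ := h'
  rcases le_total k k' with hle | hle
  · exact key hp hle hk hk' hj'
  · exact (key hp' hle hk' hk hj).symm

lemma eq_apply_or (h : NextOutside σ E p q) : (σ p ∉ E ∧ q = σ p) ∨ (σ p ∈ E ∧ ∃ z ∈ E, σ z = q) := by
  obtain ⟨hq, k, hk, hj⟩ := h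
  cases k with
  | zero => exact Or.inl ⟨by simpa [← hk] using hq, by simpa using hk.symm⟩
  | succ k =>
    exact Or.inr ⟨by simpa using hj 0 (by omega), _, hj k (by omega), by
      rw [← hk, ← Equiv.Perm.mul_apply, ← pow_succ']⟩

end NextOutside

/-- The part of the remainder away from the successors and predecessors of attachments. -/
def innerRemainder (B : Set V) (N A P Y : Finset V) : Set V := {v | v ∈ remainder B N Y ∧ v ∉ A ∧ v ∉ P}

namespace CycleFrame

variable [DecidableEq V] {c : List V} {B : Set V} {N A P Y : Finset V}

/-- If every run of a class `F` of inner vertices on the cycle, apart from the run after `y₀`, can be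
replaced by a path through vertices of `F` so that all of `F` is used, then the cycle extends. -/
lemma false_of_reroute (h : CycleFrame G c B N A P Y) (hN : N.Nonempty) {k y₀ : V} {f : V → List V}
    {F : Set V} (hF : F = {v | v ∈ innerRemainder B N A P Y ∧ ConnIn G (remainder B N Y) k v})
    (hy₀ : y₀ ∈ Y) (hσ : c.formPerm y₀ ∈ F)
    (hy₁ : ∀ q, NextOutside c.formPerm (innerRemainder B N A P Y) y₀ q → q ∈ Y)
    (hnil : ∀ p, c.formPerm p ∉ F → f p = []) (hnil₀ : f y₀ = [])
    (hf : ∀ p q, p ∈ c → p ∉ innerRemainder B N A P Y → p ≠ y₀ → p ≠ q → c.formPerm p ∈ F →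
      NextOutside c.formPerm (innerRemainder B N A P Y) p q → (p :: f p ++ [q]).IsChain G.Adj)
    (hmem : ∀ p, ∀ v ∈ f p, v ∈ F) (hnd : ∀ p, (f p).Nodup)
    (hdisj : ∀ p q, p ≠ q → (f p).Disjoint (f q))
    (hcov : ∀ v ∈ F, ∃ p ∈ c, p ∉ F ∧ v ∈ f p) : False := by
  classical
  have hFX : ∀ {v}, v ∈ F → v ∈ remainder B N Y ∧ ConnIn G (remainder B N Y) k v := by
    subst hF
    exact fun hv => ⟨hv.1.1, hv.2⟩
  have hFE : ∀ {v}, v ∈ F → v ∈ innerRemainder B N A P Y := by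
    subst hF
    exact fun hv => hv.1
  have hadjF : ∀ {u v}, u ∈ F → G.Adj u v → v ∈ innerRemainder B N A P Y → v ∈ F := by
    subst hF
    exact fun hu huv hv => ⟨hv, hu.2.trans (.of_adj hu.1.1 hv.1 huv)⟩
  have hnext : ∀ {p T q}, (p :: T ++ [q]).IsChain G.Adj →
      (p :: T ++ [q]).IsChain (fun a b => c.formPerm a = b) → (∀ v ∈ T, v ∈ F) → q ∉ F → T ≠ [] →
      NextOutside c.formPerm (innerRemainder B N A P Y) p q := by
    intro p T q hG hch hT hq hne
    refine .of_isChain hch (fun v hv => hFE (hT v hv)) fun hqE => ?_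
    have := (List.isChain_append.1 hG).2.2 (T.getLast hne) (by
      rw [List.getLast?_cons, List.getLast?_eq_some_getLast hne]; simp) q (by simp)
    exact hq (hadjF (hT _ (List.getLast_mem hne)) this hqE)
  obtain ⟨x₀, hx₀⟩ := hN
  obtain ⟨l, hl⟩ := List.exists_isRotated_cons (h.multi_mem hy₀)
  have hxF : ∀ {x}, x ∈ N → x ∉ F := fun hx hxF => (hFX hxF).1.1 hx
  have hYF : ∀ {y}, y ∈ Y → y ∉ F := fun hy hyF => (hFX hyF).1.2.2 hy
  have hAF : ∀ {a}, a ∈ A → a ∉ F := fun ha haF => (hFE haF).2.1 ha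
  have hYN : ∀ {x}, x ∈ N → x ≠ y₀ := by rintro x hx rfl; exact h.multi_notMem_attach hy₀ hx
  obtain ⟨T, y', r, rfl, hT, hy'⟩ := List.exists_append_cons_of_not (p := (· ∈ F)) (l := l)
    ⟨x₀, ((List.mem_cons.1 (hl.mem_iff.1 (h.attach_mem x₀ hx₀))).resolve_left (hYN hx₀)), hxF hx₀⟩
  have hGl := (h.isCyclicPath.rotate hl).isChain
  have hσl := hl.isChain_formPerm h.nodup
  have hinf : (y₀ :: T ++ [y']) <:+: (y₀ :: (T ++ y' :: r)) := ⟨[], r, by simp⟩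
  have hTne : T ≠ [] := by
    rintro rfl
    have := (List.isChain_cons_cons.1 hσl).1
    exact hy' (this ▸ hσ)
  have hy'Y : y' ∈ Y := hy₁ _ (hnext (hGl.of_isInfix hinf) (hσl.of_isInfix hinf) hT hy' hTne)
  have hr : c ~r T ++ y' :: r ++ [y₀] := hl.trans (List.isRotated_concat y₀ (T ++ y' :: r)).symm
  have hr' := h.rotate hr
  have hGr := hr'.isCyclicPath.isChain
  have hσr := hr.isChain_formPerm h.nodup
  have hnr := hr'.nodup
  set Q := substRuns F f (y' :: (r ++ [y₀])) with hQdef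
  have hTQ : substRuns F f (T ++ y' :: r ++ [y₀]) = Q := by
    have : T.flatMap (fun v => if v ∈ F then [] else v :: f v) = [] := by
      simpa [List.flatMap_eq_nil_iff] using hT
    rw [hQdef, substRuns, substRuns, List.append_assoc, List.flatMap_append, this]
    simp
  have hmemQ : ∀ v, v ∈ Q ↔ (v ∈ c ∧ v ∉ F) ∨ ∃ p ∈ c, p ∉ F ∧ v ∈ f p := by
    intro v
    rw [← hTQ, substRuns, List.mem_flatMap]
    simp only [← hr.mem_iff]
    constructor
    · rintro ⟨p, hp, hv⟩
      by_cases hpF : p ∈ F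
      · simp [hpF] at hv
      · simp only [hpF, if_false, List.mem_cons] at hv
        rcases hv with rfl | hv
        exacts [Or.inl ⟨hp, hpF⟩, Or.inr ⟨p, hp, hpF, hv⟩]
    · rintro (⟨hv, hvF⟩ | ⟨p, hp, hpF, hv⟩)
      exacts [⟨v, hv, by simp [hvF]⟩, ⟨p, hp, by simp [hpF, hv]⟩]
  have hQn : Q.Nodup := by
    rw [← hTQ, substRuns, List.nodup_flatMap]
    refine ⟨fun v _ => ?_, hnr.imp fun {a b} hab => ?_⟩
    · by_cases hv : v ∈ F
      · simp [hv]
      · simp only [hv, if_false, List.nodup_cons]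
        exact ⟨fun hv' => hv (hmem v v hv'), hnd v⟩
    · by_cases ha : a ∈ F
      · simp [Function.onFun, ha]
      by_cases hb : b ∈ F
      · simp [Function.onFun, hb]
      simp only [Function.onFun, ha, hb, if_false]
      intro z hza hzb
      rcases List.mem_cons.1 hza with rfl | hza <;> rcases List.mem_cons.1 hzb with e | hzb
      · exact hab e
      · exact ha (hmem _ _ hzb)
      · exact hb (e ▸ hmem _ _ hza)
      · exact hdisj a b hab hza hzb
  have hy₀last : y₀ ∈ (y' :: [] ++ (r ++ [y₀])).getLast? := by
    simp [List.getLast?_cons]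
  have hQc : Q.IsChain G.Adj := by
    refine isChain_substRuns (r ++ [y₀]) y' [] (by simp) hy' ?_ ?_
    · intro s p T' q t e hp hq hT'
      have hinf : (p :: T' ++ [q]) <:+: (T ++ y' :: r ++ [y₀]) :=
        ⟨T ++ s, t, by
          have : T ++ y' :: r ++ [y₀] = T ++ (y' :: [] ++ (r ++ [y₀])) := by simp
          rw [this, e]; simp⟩
      have hG := hGr.of_isInfix hinf
      have hσ' := hσr.of_isInfix hinf
      have hnd' := hnr.sublist hinf.sublist
      cases T' with
      | nil =>
        have e : c.formPerm p = q := by simpa using hσ'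
        rw [hnil p (e ▸ hq)]
        exact hG
      | cons z T' =>
        have hpz : c.formPerm p = z := (List.isChain_cons_cons.1 hσ').1
        have hzF := hT' z (by simp)
        have hGpz : G.Adj p z := (List.isChain_cons_cons.1 hG).1
        refine hf p q (hr.mem_iff.2 (hinf.subset (by simp))) ?_ ?_ ?_ (hpz ▸ hzF)
          (hnext hG hσ' hT' hq (by simp))
        · exact fun hpE => hp (hadjF hzF hGpz.symm hpE)
        · rintro rfl
          have hnr₂ : (y' :: [] ++ (r ++ [p])).Nodup := hnr.sublist (by simp)
          rw [e] at hnr₂ hy₀last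
          rw [List.getLast?_append_of_ne_nil _ (by simp)] at hy₀last
          have := List.mem_of_getLast? hy₀last
          simp only [List.append_assoc, List.cons_append] at hnr₂
          have := (List.nodup_cons.1 (List.nodup_append.1 hnr₂).2.1).1
          simp_all
        · rintro rfl
          simp at hnd'
    · intro q hq
      rw [Option.mem_unique hq hy₀last]
      exact ⟨hYF hy₀, hnil₀⟩
  refine h.false_of_multi_path (y := y₀) (y' := y') hQn hQc ?_ ?_ ?_ ?_ hy₀ hy'Y
    (Or.inr (Or.inr ⟨c.formPerm y₀, (hFX hσ).1, ?_, ?_⟩)) ?_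
  · intro v hv hvB
    rcases (hmemQ v).1 hv with ⟨hv, -⟩ | ⟨p, -, -, hv⟩
    · exact h.notMem v hvB hv
    · exact (hFX (hmem p v hv)).1.2.1 hvB
  · refine (List.subperm_of_subset h.nodup fun v hv => ?_).length_le
    by_cases hvF : v ∈ F
    · exact (hmemQ v).2 (Or.inr (hcov v hvF))
    · exact (hmemQ v).2 (Or.inl ⟨hv, hvF⟩)
  · simp [hQdef, substRuns, hy']
  · simp [hQdef, substRuns, hYF hy₀, hnil₀, List.getLast?_cons, List.getLast?_append]
  · obtain ⟨z, T, rfl⟩ := List.exists_cons_of_ne_nil hTne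
    rw [(List.isChain_cons_cons.1 hσl).1]
    exact (List.isChain_cons_cons.1 hGl).1
  · have := (List.isChain_append.1 (hGl.of_isInfix hinf)).2.2 (T.getLast hTne) (by
      rw [List.getLast?_cons, List.getLast?_eq_some_getLast hTne]; simp) y' (by simp)
    exact h.adj_of_connIn hy'Y this.symm
      ((hFX (hT _ (List.getLast_mem hTne))).2.symm.trans (hFX hσ).2)
  · intro x hx
    obtain ⟨s, t, e⟩ := hr.exists_cons_cons h.nodup (h.attach_mem x hx) (by
      rw [List.getLast?_append_of_ne_nil _ (by simp)]
      simpa using (hYN hx).symm)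
    have hxA : c.formPerm x ∈ A := (h.mem_succ _).2 ⟨x, hx, rfl⟩
    rw [← hTQ, e, substRuns]
    refine ⟨s.flatMap fun v => if v ∈ F then [] else v :: f v,
      f (c.formPerm x) ++ t.flatMap fun v => if v ∈ F then [] else v :: f v, ?_⟩
    simp [hxF hx, hAF hxA, hnil x (hAF hxA)]

end CycleFrame

lemma IsCyclicPath.adj_formPerm [DecidableEq V] {c : List V} (h : IsCyclicPath G c) {v : V}
    (hv : v ∈ c) : G.Adj v (c.formPerm v) := by
  obtain ⟨l, hl⟩ := List.exists_isRotated_cons hv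
  have hG := (h.rotate hl).isChain_concat
  cases l with
  | nil => simp at hG
  | cons w l =>
    rw [(List.isChain_cons_cons.1 (hl.isChain_formPerm h.1)).1]
    exact (List.isChain_cons_cons.1 hG).1

/-- If a class of `X` is hit by more elements of a larger family than of a smaller one. -/
lemma exists_card_filter_connIn_lt {ι κ : Type*} {X : Set V} {s : Finset ι} {r : Finset κ}
    {f : ι → V} {g : κ → V} [∀ u v, Decidable (ConnIn G X u v)] (hf : ∀ y ∈ s, f y ∈ X)
    (hlt : r.card < s.card) :
    ∃ y ∈ s, (r.filter fun z => ConnIn G X (f y) (g z)).card <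
      (s.filter fun z => ConnIn G X (f y) (f z)).card := by
  classical
  by_contra! hcon
  let C : V → Set V := fun v => {w | ConnIn G X v w}
  have hC : ∀ {u v}, ConnIn G X u v → C v = C u := fun huv =>
    Set.ext fun w => ⟨huv.trans, huv.symm.trans⟩
  have h₁ : s.card = ∑ K ∈ s.image (C ∘ f), (s.filter fun z => C (f z) = K).card :=
    Finset.card_eq_sum_card_fiberwise fun y hy => Finset.mem_image_of_mem _ hy
  have h₂ : ∑ K ∈ s.image (C ∘ f), (r.filter fun z => C (g z) = K).card ≤ r.card := by
    rw [← Finset.card_biUnion fun K _ L _ hKL => Finset.disjoint_filter.2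
      fun z _ hK hL => hKL (hK.symm.trans hL)]
    exact Finset.card_le_card (Finset.biUnion_subset.2 fun K _ => Finset.filter_subset _ _)
  refine hlt.not_ge (h₁.trans_le ((Finset.sum_le_sum fun K hK => ?_).trans h₂))
  obtain ⟨y, hy, rfl⟩ := Finset.mem_image.1 hK
  refine le_trans (Finset.card_le_card fun z hz => ?_) ((hcon y hy).trans
    (Finset.card_le_card fun z hz => ?_))
  · rw [Finset.mem_filter] at hz ⊢
    exact ⟨hz.1, hz.2.subset (ConnIn.refl (hf z hz.1))⟩
  · rw [Finset.mem_filter] at hz ⊢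
    exact ⟨hz.1, hC hz.2⟩

namespace CycleFrame

variable [DecidableEq V] {c : List V} {B : Set V} {N A P Y : Finset V}

lemma mem_of_notMem_inner (h : CycleFrame G c B N A P Y) {p : V} (hp : p ∈ c)
    (hpE : p ∉ innerRemainder B N A P Y) : p ∈ N ∨ p ∈ Y ∨ p ∈ A ∨ p ∈ P := by
  by_contra! hcon
  exact hpE ⟨⟨hcon.1, fun hpB => h.notMem p hpB hp, hcon.2.1⟩, hcon.2.2.1, hcon.2.2.2⟩

lemma exists_pred_of_nextOutside (h : CycleFrame G c B N A P Y) {p q : V} (hp : p ∈ c)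
    (hσ : c.formPerm p ∈ innerRemainder B N A P Y)
    (hpq : NextOutside c.formPerm (innerRemainder B N A P Y) p q) :
    ∃ z ∈ innerRemainder B N A P Y, z ∈ c ∧ c.formPerm z = q ∧
      ConnIn G (remainder B N Y) (c.formPerm p) z := by
  obtain ⟨hq, k, hk, hj⟩ := hpq
  cases k with
  | zero => exact (hq (by simpa [← hk] using hσ)).elim
  | succ k =>
    have hc : ∀ j, (c.formPerm ^ j) p ∈ c := by
      intro j
      induction j with
      | zero => simpa
      | succ j ih =>
        rw [pow_succ', Equiv.Perm.mul_apply]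
        exact List.formPerm_apply_mem_of_mem ih
    refine ⟨(c.formPerm ^ (k + 1)) p, hj k (by omega), hc _, by
      rw [← hk, ← Equiv.Perm.mul_apply, ← pow_succ'], ?_⟩
    have : ∀ j ≤ k, ConnIn G (remainder B N Y) (c.formPerm p) ((c.formPerm ^ (j + 1)) p) := by
      intro j hjk
      induction j with
      | zero => simpa using ConnIn.refl hσ.1
      | succ j ih =>
        refine (ih (by omega)).trans (.of_adj (hj j (by omega)).1 (hj _ (by omega)).1 ?_)
        rw [pow_succ' _ (j + 1), Equiv.Perm.mul_apply]
        exact h.isCyclicPath.adj_formPerm (hc _)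
    exact this k le_rfl

lemma left_mem_of_next_inner (h : CycleFrame G c B N A P Y) {p : V} (hp : p ∈ c)
    (hpE : p ∉ innerRemainder B N A P Y) (hσ : c.formPerm p ∈ innerRemainder B N A P Y) :
    p ∈ Y ∨ p ∈ A := by
  rcases h.mem_of_notMem_inner hp hpE with hp | hp | hp | hp
  · exact (hσ.2.1 ((h.mem_succ _).2 ⟨p, hp, rfl⟩)).elim
  · exact Or.inl hp
  · exact Or.inr hp
  · exact (hσ.1.1 ((h.mem_pred p).1 hp)).elim

lemma right_mem_of_inner (h : CycleFrame G c B N A P Y) {z : V} (hz : z ∈ c)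
    (hzE : z ∈ innerRemainder B N A P Y) (hσ : c.formPerm z ∉ innerRemainder B N A P Y) :
    c.formPerm z ∈ Y ∨ c.formPerm z ∈ P := by
  rcases h.mem_of_notMem_inner (List.formPerm_apply_mem_of_mem hz) hσ with hp | hp | hp | hp
  · exact (hzE.2.2 ((h.mem_pred z).2 hp)).elim
  · exact Or.inl hp
  · obtain ⟨x, hx, hxz⟩ := (h.mem_succ _).1 hp
    rw [c.formPerm.injective hxz] at hx
    exact (hzE.1.1 hx).elim
  · exact Or.inr hp

/-- All but `N.card` vertices of `Y` are followed, after a run of inner vertices, by another one. -/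
lemma card_multi_le [Finite V] (h : CycleFrame G c B N A P Y) {Y' : Finset V}
    (hY' : ∀ y ∈ Y, (∀ q, NextOutside c.formPerm (innerRemainder B N A P Y) y q → q ∈ Y) → y ∈ Y') :
    Y.card ≤ Y'.card + N.card := by
  suffices hle : (Y \ Y').card ≤ N.card by
    have := Finset.le_card_sdiff Y' Y
    omega
  have hYE : ∀ {y}, y ∈ Y \ Y' → y ∉ innerRemainder B N A P Y := fun hy hyE =>
    hyE.1.2.2 (Finset.mem_sdiff.1 hy).1
  refine Finset.card_le_card_of_forall_subsingleton (fun y x => ∃ q,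
    NextOutside c.formPerm (innerRemainder B N A P Y) y q ∧ q ∉ Y ∧
      (q = x ∧ q = c.formPerm y ∨ q ∉ N ∧ c.formPerm q = x)) ?_ ?_
  · intro y hy
    obtain ⟨hyY, hyY'⟩ := Finset.mem_sdiff.1 hy
    obtain ⟨q, hq, hqY⟩ : ∃ q, NextOutside c.formPerm (innerRemainder B N A P Y) y q ∧ q ∉ Y := by
      by_contra! hcon
      exact hyY' (hY' y hyY hcon)
    have hyc := h.multi_mem hyY
    have hPN : q ∈ P → ∃ x ∈ N, ∃ q, NextOutside c.formPerm (innerRemainder B N A P Y) y q ∧ q ∉ Y ∧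
      (q = x ∧ q = c.formPerm y ∨ q ∉ N ∧ c.formPerm q = x) := fun hqP =>
      ⟨_, (h.mem_pred q).1 hqP, q, hq, hqY, Or.inr ⟨h.pred_notMem_attach hqP, rfl⟩⟩
    rcases hq.eq_apply_or with ⟨hσ, rfl⟩ | ⟨hσ, -⟩
    · rcases h.mem_of_notMem_inner (List.formPerm_apply_mem_of_mem hyc) hσ with hp | hp | hp | hp
      · exact ⟨_, hp, _, hq, hqY, Or.inl ⟨rfl, rfl⟩⟩
      · exact (hqY hp).elim
      · obtain ⟨x, hx, hxy⟩ := (h.mem_succ _).1 hp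
        rw [c.formPerm.injective hxy] at hx
        exact (h.multi_notMem_attach hyY hx).elim
      · exact hPN hp
    · obtain ⟨z, hzE, hzc, rfl, -⟩ := h.exists_pred_of_nextOutside hyc hσ hq
      exact hPN ((h.right_mem_of_inner hzc hzE hq.1).resolve_left hqY)
  · rintro x hx y ⟨hy, q, hq, hqY, hqx⟩ y' ⟨hy', q', hq', hqY', hqx'⟩
    have key : q = q' → y = y' := by
      rintro rfl
      exact hq.left_unique hq' (hYE hy) (hYE hy')
    rcases hqx with ⟨h₁, h₂⟩ | ⟨h₁, h₂⟩ <;> rcases hqx' with ⟨h₁', h₂'⟩ | ⟨h₁', h₂'⟩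
    · exact key (h₁.trans h₁'.symm)
    · have : q' = y := c.formPerm.injective (by rw [h₂', ← h₁, h₂])
      exact (hqY' (this ▸ (Finset.mem_sdiff.1 hy).1)).elim
    · have : q = y' := c.formPerm.injective (by rw [h₂, ← h₁', h₂'])
      exact (hqY (this ▸ (Finset.mem_sdiff.1 hy').1)).elim
    · exact key (c.formPerm.injective (h₂.trans h₂'.symm))

lemma mul_card_succ_le [Finite V] (h : CycleFrame G c B N A P Y) {t : ℝ} (htough : Tough t G)
    (ht : 0 ≤ t) (hN : 4 ≤ N.card) : t * (N.card + 1) ≤ N.card + Y.card := by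
  obtain ⟨b, hb⟩ := h.nonempty
  have hbA : b ∉ A := fun hbA => h.succ_notMem hbA hb
  have hbadj : ∀ {a}, a ∈ A → ¬ G.Adj b a := fun ha hba =>
    (h.closed b hb _ hba).elim (h.succ_notMem ha) (h.succ_notMem_attach ha)
  have hnb : ∀ {v a}, a ∈ A → G.Adj v b → G.Adj v a → v ∈ N := by
    intro v a ha hvb hva
    refine (h.closed b hb v hvb.symm).resolve_left fun hvB => ?_
    exact (h.closed v hvB a hva).elim (h.succ_notMem ha) (h.succ_notMem_attach ha)
  have hcard : (insert b A).card = N.card + 1 := by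
    rw [Finset.card_insert_of_notMem hbA, h.card_succ]
  have := h.free.mul_card_le_ncard htough ht (I := insert b A) (by
    simp only [Finset.mem_insert, forall_eq_or_imp]
    exact ⟨⟨G.loopless.irrefl b, fun a => hbadj⟩, fun a ha =>
      ⟨fun hab => hbadj ha hab.symm, fun a' => h.succ_indep ha⟩⟩) (by omega)
  rw [hcard] at this
  push_cast at this
  refine this.trans ?_
  have hsub : {v | ∃ i ∈ insert b A, ∃ j ∈ insert b A, i ≠ j ∧ G.Adj v i ∧ G.Adj v j} ⊆
      ((N ∪ Y : Finset V) : Set V) := by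
    rintro v ⟨i, hi, j, hj, hij, hvi, hvj⟩
    rw [Finset.coe_union]
    rw [Finset.mem_insert] at hi hj
    rcases hi with rfl | hi <;> rcases hj with rfl | hj
    · exact (hij rfl).elim
    · exact Or.inl (hnb hj hvi hvj)
    · exact Or.inl (hnb hi hvj hvi)
    · by_cases hvN : v ∈ N
      · exact Or.inl hvN
      · exact Or.inr ((h.mem_multi v).2 ⟨hvN, i, hi, j, hj, hij, hvi, hvj⟩)
  have := (Set.ncard_le_ncard hsub).trans_eq (Set.ncard_coe_finset _)
  exact_mod_cast this.trans (Finset.card_union_le _ _)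

end CycleFrame

lemma ConnIn.of_isChain {X : Set V} {a : V} {l : List V} (h : (a :: l).IsChain G.Adj)
    (hX : ∀ v ∈ a :: l, v ∈ X) : ∀ v ∈ a :: l, ConnIn G X a v := by
  induction l generalizing a with
  | nil => simpa using ConnIn.refl (hX a (by simp))
  | cons b l ih =>
    rw [List.isChain_cons_cons] at h
    intro v hv
    rcases List.mem_cons.1 hv with rfl | hv
    · exact .refl (hX _ (by simp))
    · exact (ConnIn.of_adj (hX a (by simp)) (hX b (by simp)) h.1).trans
        (ih h.2 (fun w hw => hX w (List.mem_cons_of_mem _ hw)) v hv)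

lemma mem_iff_of_flatten {ps : List (List V)} {F : Finset V}
    (hF : (ps.flatten : Multiset V) = F.val) {v : V} : v ∈ F ↔ ∃ p ∈ ps, v ∈ p := by
  rw [← Finset.mem_val, ← hF, Multiset.mem_coe, List.mem_flatten]

lemma nodup_of_flatten {ps : List (List V)} {F : Finset V} (hne : ∀ p ∈ ps, p ≠ [])
    (hF : (ps.flatten : Multiset V) = F.val) : ps.Nodup := by
  have hn : ps.flatten.Nodup := by
    rw [← Multiset.coe_nodup, hF]
    exact F.nodup
  refine (List.nodup_flatten.1 hn).2.imp_of_mem fun {a b} ha _ hab e => ?_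
  obtain ⟨v, hv⟩ := List.exists_mem_of_ne_nil a (hne a ha)
  exact hab hv (e ▸ hv)

namespace CycleFrame

variable [DecidableEq V] {c : List V} {B : Set V} {N A P Y : Finset V}

lemma mul_card_scattered_le [Finite V] (h : CycleFrame G c B N A P Y) {t : ℝ} (htough : Tough t G)
    (ht : 0 ≤ t) {F U W I : Finset V} (hF : ∀ v, v ∈ F ↔ v ∈ innerRemainder B N A P Y ∧ v ∉ U)
    (hUE : ∀ u ∈ U, u ∈ innerRemainder B N A P Y) (hU : U.card ≤ N.card) (hWF : W ⊆ F) (hIF : I ⊆ F) (hd : Disjoint I W)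
    (hI : ∀ i ∈ I, ∀ j ∈ I, i ≠ j → ¬ ConnIn G {v | v ∈ F ∧ v ∉ W} i j) (hne : I.Nonempty) :
    t * (I.card + 1) ≤ 4 * N.card + Y.card + W.card := by
  obtain ⟨b, hb⟩ := h.nonempty
  let Z : Finset V := N ∪ Y ∪ A ∪ P ∪ U ∪ W
  have hZ : ∀ {v}, v ∉ Z ↔ v ∉ N ∧ v ∉ Y ∧ v ∉ A ∧ v ∉ P ∧ v ∉ U ∧ v ∉ W := by
    simp [Z]
  have hFZ : ∀ {v}, v ∈ F → v ∉ W → v ∉ Z := by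
    intro v hv hvW
    obtain ⟨⟨⟨h₁, -, h₂⟩, h₃, h₄⟩, h₅⟩ := (hF v).1 hv
    exact hZ.2 ⟨h₁, h₂, h₃, h₄, h₅, hvW⟩
  have hbZ : b ∉ Z := hZ.2 ⟨fun hbN => h.notMem b hb (h.attach_mem b hbN),
    fun hbY => h.multi_notMem hbY hb, fun hbA => h.succ_notMem hbA hb,
    fun hbP => h.notMem b hb (h.pred_mem hbP), fun hbU => ?_, fun hbW => ?_⟩
  rotate_left
  · exact (hUE b hbU).1.2.1 hb
  · exact ((hF b).1 (hWF hbW)).1.1.2.1 hb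
  have hbI : b ∉ I := fun hbI => ((hF b).1 (hIF hbI)).1.1.2.1 hb
  have hB : ∀ {v}, ConnIn G (Z : Set V)ᶜ b v → v ∈ B := fun hbv =>
    hbv.closed (D := B) (fun a ha v hv _ hav => (h.closed a ha v hav).resolve_right
      (hZ.1 (by simpa using hv)).1) hb
  have hIF' : ∀ {i v}, i ∈ I → ConnIn G (Z : Set V)ᶜ i v → ConnIn G {v | v ∈ F ∧ v ∉ W} i v := by
    intro i v hi hiv
    refine hiv.closed (D := {v | ConnIn G {v | v ∈ F ∧ v ∉ W} i v}) (fun a ha v hv _ hav => ?_)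
      (.refl ⟨hIF hi, Finset.disjoint_left.1 hd hi⟩)
    obtain ⟨haF, haW⟩ := ha.right_mem
    obtain ⟨⟨⟨haN, haB, -⟩, -⟩, -⟩ := (hF a).1 haF
    obtain ⟨hvN, hvY, hvA, hvP, hvU, hvW⟩ := hZ.1 (show v ∉ Z by simpa using hv)
    exact ha.trans (.of_adj ⟨haF, haW⟩ ⟨(hF v).2 ⟨⟨⟨hvN, fun hvB =>
      (h.closed v hvB a hav.symm).elim haB haN, hvY⟩, hvA, hvP⟩, hvU⟩, hvW⟩ hav)
  have key := htough.mul_card_le ht (I := insert b I) (Z := (Z : Set V)) (by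
    simp only [Finset.mem_insert, forall_eq_or_imp, Finset.mem_coe]
    exact ⟨hbZ, fun i hi => hFZ (hIF hi) (Finset.disjoint_left.1 hd hi)⟩) (by
    have hbi : ∀ i ∈ I, ¬ ConnIn G (Z : Set V)ᶜ b i := fun i hi hbi =>
      ((hF i).1 (hIF hi)).1.1.2.1 (hB hbi)
    simp only [Finset.mem_insert, forall_eq_or_imp]
    exact ⟨⟨fun h => (h rfl).elim, fun i hi _ => hbi i hi⟩, fun i hi =>
      ⟨fun _ hib => hbi i hi hib.symm, fun j hj hij hc => hI i hi j hj hij (hIF' hi hc)⟩⟩) (by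
    rw [Finset.card_insert_of_notMem hbI]
    have := hne.card_pos
    omega)
  rw [Finset.card_insert_of_notMem hbI, Set.ncard_coe_finset] at key
  push_cast at key
  refine key.trans ?_
  have h₁ : Z.card ≤ 4 * N.card + Y.card + W.card := by
    change (N ∪ Y ∪ A ∪ P ∪ U ∪ W).card ≤ _
    have := h.card_succ
    have := h.card_pred_le
    have := Finset.card_union_le (N ∪ Y ∪ A ∪ P ∪ U) W
    have := Finset.card_union_le (N ∪ Y ∪ A ∪ P) U
    have := Finset.card_union_le (N ∪ Y ∪ A) P
    have := Finset.card_union_le (N ∪ Y) A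
    have := Finset.card_union_le N Y
    omega
  exact_mod_cast h₁

/-- If an inner run joins `a ∈ A` to a predecessor `b`, then `a` and `b` are equal, adjacent, or have a
common inner neighbour. -/
lemma exists_inner_common_neighbor (h : CycleFrame G c B N A P Y) {a b : V} (ha : a ∈ A)
    (hσ : c.formPerm a ∈ innerRemainder B N A P Y)
    (hab : NextOutside c.formPerm (innerRemainder B N A P Y) a b) (hb : b ∈ P) (hbY : b ∉ Y)
    (hne : a ≠ b) (hnadj : ¬ G.Adj a b) :
    ∃ u ∈ innerRemainder B N A P Y, G.Adj a u ∧ G.Adj u b := by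
  obtain ⟨z, hz, hzc, rfl, hconn⟩ := h.exists_pred_of_nextOutside (h.succ_mem ha) hσ hab
  have hbX : c.formPerm z ∈ remainder B N Y :=
    ⟨h.pred_notMem_attach hb, fun hbB => h.notMem _ hbB (h.pred_mem hb), hbY⟩
  have hconn' : ConnIn G (remainder B N Y) a (c.formPerm z) :=
    ((ConnIn.of_adj (h.succ_mem_remainder ha) hσ.1
      (h.isCyclicPath.adj_formPerm (h.succ_mem ha))).trans hconn).trans
      (.of_adj hz.1 hbX (h.isCyclicPath.adj_formPerm hzc))
  obtain ⟨u, hu, hau, hub⟩ := h.noP4On_remainder.exists_common_neighbor hconn' hne hnadj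
  exact ⟨u, ⟨hu, fun huA => h.succ_indep ha huA hau, fun huP => h.pred_indep huP hb hub⟩, hau, hub⟩


lemma false_of_tough [Finite V] (h : CycleFrame G c B N A P Y) {t : ℝ} (htough : Tough t G)
    (ht : 4.5 ≤ t) (hN : 4 ≤ N.card) : False := by
  classical
  have := Fintype.ofFinite V
  set E := innerRemainder B N A P Y with hE
  set X := remainder B N Y with hX
  have hYA : ∀ {y}, y ∈ Y → y ∉ A := fun hy hA => h.succ_notMem_multi hA hy
  let gap : V → V → Prop := fun a b => c.formPerm a ∈ E ∧ NextOutside c.formPerm E a b ∧ b ∈ P ∧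
    b ∉ Y ∧ a ≠ b ∧ ¬ G.Adj a b
  obtain ⟨u, hu⟩ : ∃ u : V → V, ∀ a ∈ A, ∀ b, gap a b → u a ∈ E ∧ G.Adj a (u a) ∧ G.Adj (u a) b := by
    have : ∀ a, ∃ w, a ∈ A → ∀ b, gap a b → w ∈ E ∧ G.Adj a w ∧ G.Adj w b := by
      intro a
      by_cases hab : a ∈ A ∧ ∃ b, gap a b
      · obtain ⟨ha, b, hb⟩ := hab
        obtain ⟨w, hw⟩ := h.exists_inner_common_neighbor ha hb.1 hb.2.1 hb.2.2.1 hb.2.2.2.1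
          hb.2.2.2.2.1 hb.2.2.2.2.2
        exact ⟨w, fun _ b' hb' => hb'.2.1.right_unique hb.2.1 ▸ hw⟩
      · exact ⟨a, fun ha b hb => (hab ⟨ha, b, hb⟩).elim⟩
    choose u hu using this
    exact ⟨u, hu⟩
  let T := A.filter fun a => ∃ b, gap a b
  have hT : ∀ {a}, a ∈ T ↔ a ∈ A ∧ ∃ b, gap a b := by simp [T]
  let U := T.image u
  have huE : ∀ {a}, a ∈ T → u a ∈ E := fun ha => by
    obtain ⟨haA, b, hb⟩ := hT.1 ha
    exact (hu _ haA b hb).1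
  have hUE : ∀ v ∈ U, v ∈ E := by
    simp only [U, Finset.mem_image, forall_exists_index, and_imp]
    rintro _ a ha rfl
    exact huE ha
  have huX : ∀ {a}, a ∈ T → ConnIn G X a (u a) := fun ha => by
    obtain ⟨haA, b, hb⟩ := hT.1 ha
    exact .of_adj (h.succ_mem_remainder haA) (huE ha).1 (hu _ haA b hb).2.1
  have hUN : U.card ≤ N.card :=
    Finset.card_image_le.trans ((Finset.card_filter_le _ _).trans h.card_succ.le)
  let F : Finset V := Finset.univ.filter fun v => v ∈ E ∧ v ∉ U
  have hF : ∀ v, v ∈ F ↔ v ∈ E ∧ v ∉ U := by simp [F]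
  obtain ⟨q, W, I, ⟨ps, rfl, hps, hflat⟩, hWF, hIF, hd, hcard, hI⟩ :=
    (h.noP4On_remainder.mono fun v hv => ((hF v).1 hv).1.1 : NoP4On G (F : Set V)).scatteredCover
  let Y' := Y.filter fun y => ∀ q, NextOutside c.formPerm E y q → q ∈ Y
  have hY' : ∀ {y}, y ∈ Y' ↔ y ∈ Y ∧ ∀ q, NextOutside c.formPerm E y q → q ∈ Y := by simp [Y']
  have hlt : ps.length < Y'.card := by
    have h₁ := h.card_multi_le (Y' := Y') fun y hy hyq => hY'.2 ⟨hy, hyq⟩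
    have h₂ := h.mul_card_succ_le htough (by linarith) hN
    have h₂' : (4.5 : ℝ) * (N.card + 1) ≤ N.card + Y.card :=
      le_trans (by gcongr) h₂
    have h₁' : (Y.card : ℝ) ≤ Y'.card + N.card := mod_cast h₁
    have hs : (4 : ℝ) ≤ N.card := mod_cast hN
    have hW : (W.card : ℝ) + ps.length ≤ I.card := mod_cast hcard
    have hW₀ : (0 : ℝ) ≤ W.card := Nat.cast_nonneg _
    suffices (ps.length : ℝ) < Y'.card by exact_mod_cast this
    rcases I.eq_empty_or_nonempty with rfl | hne
    · simp only [Finset.card_empty, Nat.cast_zero] at hW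
      linarith
    · have h₃ := h.mul_card_scattered_le htough (by linarith) hF hUE hUN hWF hIF hd hI hne
      have h₃' : (4.5 : ℝ) * (I.card + 1) ≤ 4 * N.card + Y.card + W.card :=
        le_trans (by gcongr) h₃
      linarith
  have hσE : ∀ {y}, y ∈ Y' → c.formPerm y ∈ E := by
    intro y hy
    obtain ⟨hyY, hyq⟩ := hY'.1 hy
    by_contra hσ
    exact h.next_multi_notMem hyY (hyq _ ⟨hσ, 0, by simp, by simp⟩)
  obtain ⟨b, hb⟩ := h.nonempty
  let rep : List V → V := fun p => p.headD b
  have hps' : ps.Nodup := nodup_of_flatten (fun p hp => (hps p hp).1) hflat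
  have hrep : ∀ p ∈ ps, ∀ v ∈ p, ConnIn G X (rep p) v := by
    intro p hp
    obtain ⟨a, l, rfl⟩ := List.exists_cons_of_ne_nil (hps p hp).1
    refine fun v hv => ConnIn.of_isChain (hps _ hp).2 (fun w hw => ?_) v hv
    exact ((hF w).1 ((mem_iff_of_flatten hflat).2 ⟨_, hp, hw⟩)).1.1
  obtain ⟨y₀, hy₀, hK⟩ := exists_card_filter_connIn_lt (G := G) (X := X) (s := Y')
    (r := ps.toFinset) (f := c.formPerm) (g := rep) (fun y hy => (hσE hy).1)
    (by rwa [List.toFinset_card_of_nodup hps'])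
  set k := c.formPerm y₀ with hk
  let YK := Y'.filter fun y => ConnIn G X k (c.formPerm y)
  have hYK : ∀ {y}, y ∈ YK ↔ y ∈ Y' ∧ ConnIn G X k (c.formPerm y) := by simp [YK]
  have hy₀K : y₀ ∈ YK := hYK.2 ⟨hy₀, .refl (hσE hy₀).1⟩
  let FK := F.filter fun v => ConnIn G X k v
  have hFK : ∀ {v}, v ∈ FK ↔ (v ∈ E ∧ v ∉ U) ∧ ConnIn G X k v := by simp [FK, hF]
  have hqs : PathCover G FK (ps.toFinset.filter fun p => ConnIn G X k (rep p)).card := by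
    refine ⟨ps.filter fun p => ConnIn G X k (rep p), ?_, fun p hp =>
      hps p (List.mem_filter.1 hp).1, ?_⟩
    · rw [← List.toFinset_card_of_nodup (hps'.filter _), List.toFinset_filter]
      simp
    · have hn : ps.flatten.Nodup := by
        rw [← Multiset.coe_nodup, hflat]
        exact F.nodup
      refine (Multiset.Nodup.ext ?_ FK.nodup).2 fun v => ?_
      · exact Multiset.coe_nodup.2 (hn.sublist List.filter_sublist.flatten)
      · rw [Multiset.mem_coe, List.mem_flatten, Finset.mem_val, hFK, ← hF, mem_iff_of_flatten hflat]
        constructor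
        · rintro ⟨p, hp, hv⟩
          rw [List.mem_filter, decide_eq_true_eq] at hp
          exact ⟨⟨p, hp.1, hv⟩, hp.2.trans (hrep p hp.1 v hv)⟩
        · rintro ⟨⟨p, hp, hv⟩, hkv⟩
          refine ⟨p, ?_, hv⟩
          rw [List.mem_filter, decide_eq_true_eq]
          exact ⟨hp, hkv.trans (hrep p hp v hv).symm⟩
  have hTK : ∀ {a a'}, a ∈ T → a' ∈ T → ConnIn G X k a → ConnIn G X k a' → a = a' :=
    fun ha ha' hka hka' => h.eq_of_connIn (hT.1 ha).1 (hT.1 ha').1 (hka.symm.trans hka')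
  have hYKcard : YK.card ≤ FK.card + 1 := by
    have hUK : (U.filter fun v => ConnIn G X k v).card ≤ 1 := by
      rw [Finset.card_le_one]
      simp only [U, Finset.mem_filter, Finset.mem_image]
      rintro _ ⟨⟨a, ha, rfl⟩, hka⟩ _ ⟨⟨a', ha', rfl⟩, hka'⟩
      rw [hTK ha ha' (hka.trans (huX ha).symm) (hka'.trans (huX ha').symm)]
    rw [← Finset.card_image_of_injective YK c.formPerm.injective]
    refine (Finset.card_le_card (t := FK ∪ U.filter fun v => ConnIn G X k v) ?_).trans
      ((Finset.card_union_le _ _).trans (by gcongr))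
    intro v hv
    obtain ⟨y, hy, rfl⟩ := Finset.mem_image.1 hv
    obtain ⟨hy, hky⟩ := hYK.1 hy
    rw [Finset.mem_union, hFK, Finset.mem_filter]
    by_cases hyU : c.formPerm y ∈ U
    exacts [Or.inr ⟨hyU, hky⟩, Or.inl ⟨⟨hσE hy, hyU⟩, hky⟩]
  replace hK : (ps.toFinset.filter fun p => ConnIn G X k (rep p)).card < YK.card := hK
  obtain ⟨rs, hrs, hrs₁, hrsF⟩ := hqs.mono (r := YK.card - 1) (by omega) (by omega)
  have hrs' : rs.Nodup := nodup_of_flatten (fun p hp => (hrs₁ p hp).1) hrsF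
  have hrsn : rs.flatten.Nodup := by
    rw [← Multiset.coe_nodup, hrsF]
    exact FK.nodup
  have hmem : ∀ {p v}, p ∈ rs → v ∈ p → v ∈ FK := fun hp hv => (mem_iff_of_flatten hrsF).2 ⟨_, hp, hv⟩
  have hmk : ∀ {p v}, p ∈ rs → v ∈ p → ConnIn G X k v := fun hp hv => (hFK.1 (hmem hp hv)).2
  obtain ⟨g, hg⟩ := (YK.erase y₀).finite_toSet.exists_bijOn_of_encard_eq
    (t := (rs.toFinset : Set (List V))) (by
      rw [Set.encard_coe_eq_coe_finsetCard, Set.encard_coe_eq_coe_finsetCard,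
        Finset.card_erase_of_mem hy₀K, List.toFinset_card_of_nodup hrs', hrs])
  have hgm : ∀ {y}, y ∈ YK.erase y₀ → g y ∈ rs := fun hy => by
    simpa using hg.mapsTo hy
  let f : V → List V := fun v =>
    if v ∈ YK.erase y₀ then g v else if v ∈ T ∧ ConnIn G X k v then [u v] else []
  have hfY : ∀ {v}, v ∈ YK.erase y₀ → f v = g v := fun hv => by simp only [f, if_pos hv]
  have hTY : ∀ {v}, v ∈ T → v ∉ YK.erase y₀ := fun hv hvY =>
    hYA (hY'.1 (hYK.1 (Finset.mem_of_mem_erase hvY)).1).1 (hT.1 hv).1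
  have hfT : ∀ {v}, v ∈ T → ConnIn G X k v → f v = [u v] := fun hv hkv => by
    simp only [f, if_neg (hTY hv), if_pos (And.intro hv hkv)]
  have hf₀ : ∀ {v}, v ∉ YK.erase y₀ → v ∉ T → f v = [] := fun hv hv' => by
    simp only [f, if_neg hv, if_neg (not_and_of_not_left _ hv')]
  have hfcases : ∀ p v, v ∈ f p → (p ∈ YK.erase y₀ ∧ v ∈ g p) ∨
      (p ∈ T ∧ ConnIn G X k p ∧ v = u p) := by
    intro p v hv
    simp only [f] at hv
    split_ifs at hv with h₁ h₂
    · exact Or.inl ⟨h₁, hv⟩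
    · exact Or.inr ⟨h₂.1, h₂.2, by simpa using hv⟩
    · simp at hv
  refine h.false_of_reroute (Finset.card_pos.1 (by omega)) (k := k) (y₀ := y₀) (f := f) rfl
    (hY'.1 hy₀).1 ⟨hσE hy₀, .refl (hσE hy₀).1⟩ (hY'.1 hy₀).2 ?_ ?_ ?_ ?_ ?_ ?_ ?_
  · intro p hp
    refine List.eq_nil_iff_forall_not_mem.2 fun v hv => ?_
    rcases hfcases p v hv with ⟨hpY, -⟩ | ⟨hpT, hkp, -⟩
    · obtain ⟨hpY', hkp⟩ := hYK.1 (Finset.mem_of_mem_erase hpY)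
      exact hp ⟨hσE hpY', hkp⟩
    · obtain ⟨hpA, b', hσp, -⟩ := hT.1 hpT
      exact hp ⟨hσp, hkp.trans (.of_adj (h.succ_mem_remainder hpA) hσp.1
        (h.isCyclicPath.adj_formPerm (h.succ_mem hpA)))⟩
  · exact hf₀ (by simp) fun hT' => hYA (hY'.1 hy₀).1 (hT.1 hT').1
  · rintro p q hpc hpE hp₀ hpq ⟨hσp, hkp⟩ hnext
    obtain ⟨z, hzE, hzc, rfl, hpz⟩ := h.exists_pred_of_nextOutside hpc hσp hnext
    have hpσ := h.isCyclicPath.adj_formPerm hpc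
    have hzσ := h.isCyclicPath.adj_formPerm hzc
    have hkz := hkp.trans hpz
    rcases em (p ∈ Y) with hpY | hpY
    · have hpT : p ∉ T := fun hpT => hYA hpY (hT.1 hpT).1
      by_cases hqY : c.formPerm z ∈ Y
      · have hpR : p ∈ YK.erase y₀ := Finset.mem_erase.2 ⟨hp₀, hYK.2
          ⟨hY'.2 ⟨hpY, fun q hq => hnext.right_unique hq ▸ hqY⟩, hkp⟩⟩
        rw [hfY hpR, List.isChain_append, List.isChain_cons]
        have hgr := hgm hpR
        refine ⟨⟨fun v hv => h.adj_of_connIn hpY hpσ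
          (hkp.symm.trans (hmk hgr (List.mem_of_mem_head? hv))), (hrs₁ _ hgr).2⟩, by simp, ?_⟩
        intro v hv w hw
        obtain rfl : c.formPerm z = w := by simpa using hw
        rw [List.getLast?_cons, Option.mem_some_iff] at hv
        subst hv
        obtain ⟨v, hv⟩ := Option.isSome_iff_exists.1
          (List.getLast?_isSome.2 (hrs₁ _ hgr).1)
        rw [hv, Option.getD_some]
        exact (h.adj_of_connIn hqY hzσ.symm
          (hkz.symm.trans (hmk hgr (List.mem_of_getLast? hv)))).symm
      · have hpR : p ∉ YK.erase y₀ := fun hpR =>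
          hqY ((hY'.1 (hYK.1 (Finset.mem_of_mem_erase hpR)).1).2 _ hnext)
        rw [hf₀ hpR hpT]
        have hqP := (h.right_mem_of_inner hzc hzE hnext.1).resolve_left hqY
        have hqX : c.formPerm z ∈ X :=
          ⟨h.pred_notMem_attach hqP, fun hqB => h.notMem _ hqB (h.pred_mem hqP), hqY⟩
        simpa using h.adj_of_connIn hpY hpσ (hpz.trans (.of_adj hzE.1 hqX hzσ))
    · have hpA := (h.left_mem_of_next_inner hpc hpE hσp).resolve_left hpY
      have hpR : p ∉ YK.erase y₀ := fun hpR =>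
        hpY (hY'.1 (hYK.1 (Finset.mem_of_mem_erase hpR)).1).1
      have hpX := h.succ_mem_remainder hpA
      have hσX : ConnIn G X p (c.formPerm p) := .of_adj hpX hσp.1 hpσ
      by_cases hpT : p ∈ T
      · obtain ⟨-, b', hb'⟩ := hT.1 hpT
        obtain rfl := hb'.2.1.right_unique hnext
        obtain ⟨-, h₁, h₂⟩ := hu p hpA _ hb'
        rw [hfT hpT (hkp.trans hσX.symm)]
        simpa using ⟨h₁, h₂⟩
      · rw [hf₀ hpR hpT]
        suffices G.Adj p (c.formPerm z) by simpa using this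
        by_cases hqY : c.formPerm z ∈ Y
        · exact (h.adj_of_connIn hqY hzσ.symm (hpz.symm.trans hσX.symm)).symm
        · by_contra hadj
          exact hpT (hT.2 ⟨hpA, _, hσp, hnext,
            (h.right_mem_of_inner hzc hzE hnext.1).resolve_left hqY, hqY, hpq, hadj⟩)
  · intro p v hv
    rcases hfcases p v hv with ⟨hp, hv⟩ | ⟨hp, hkp, rfl⟩
    · obtain ⟨⟨hvE, -⟩, hkv⟩ := hFK.1 (hmem (hgm hp) hv)
      exact ⟨hvE, hkv⟩
    · exact ⟨huE hp, hkp.trans (huX hp)⟩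
  · intro p
    simp only [f]
    split_ifs with h₁
    · exact (List.nodup_flatten.1 hrsn).1 _ (hgm h₁)
    all_goals simp
  · intro p q hpq v hvp hvq
    have hgU : ∀ {p q}, p ∈ YK.erase y₀ → q ∈ T → u q ∉ g p := fun hp hq hv =>
      (hFK.1 (hmem (hgm hp) hv)).1.2 (Finset.mem_image_of_mem u hq)
    rcases hfcases p v hvp with ⟨hp, hv⟩ | ⟨hp, hkp, rfl⟩ <;>
      rcases hfcases q _ hvq with ⟨hq, hv'⟩ | ⟨hq, hkq, e⟩
    · have : Std.Symm (List.Disjoint (α := V)) := ⟨fun _ _ hd => hd.symm⟩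
      exact (List.nodup_flatten.1 hrsn).2.forall (hgm hp) (hgm hq)
        (fun e => hpq (hg.injOn hp hq e)) hv hv'
    · exact hgU hp hq (e ▸ hv)
    · exact hgU hq hp hv'
    · exact hpq (hTK hp hq hkp hkq)
  · rintro v ⟨hvE, hkv⟩
    by_cases hvU : v ∈ U
    · obtain ⟨a, ha, rfl⟩ := Finset.mem_image.1 hvU
      refine ⟨a, h.succ_mem (hT.1 ha).1, fun haF => haF.1.2.1 (hT.1 ha).1, ?_⟩
      rw [hfT ha (hkv.trans (huX ha).symm)]
      simp
    · obtain ⟨r, hr, hvr⟩ := (mem_iff_of_flatten hrsF).1 (hFK.2 ⟨⟨hvE, hvU⟩, hkv⟩)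
      obtain ⟨y, hy, rfl⟩ := hg.surjOn (show r ∈ (rs.toFinset : Set (List V)) by simpa using hr)
      have hyY := (hY'.1 (hYK.1 (Finset.mem_of_mem_erase hy)).1).1
      exact ⟨y, h.multi_mem hyY, fun hyF => hyF.1.1.2.2 hyY, by rwa [hfY hy]⟩

end CycleFrame

lemma ConnIn.exists_path {X : Set V} {u v : V} (h : ConnIn G X u v) :
    ∃ l : List V, l.Nodup ∧ l.IsChain G.Adj ∧ (∀ w ∈ l, ConnIn G X u w) ∧ u ∈ l.head? ∧
      v ∈ l.getLast? := by
  classical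
  obtain ⟨p, hp⟩ := h
  refine ⟨p.bypass.support, p.bypass_isPath.support_nodup, p.bypass.isChain_adj_support, ?_, ?_, ?_⟩
  · intro w hw
    have hw' := p.support_bypass_subset_support hw
    exact ⟨p.takeUntil w hw', fun z hz => hp z (p.support_takeUntil_subset_support _ hz)⟩
  · rw [List.head?_eq_some_head p.bypass.support_ne_nil]; simp
  · rw [List.getLast?_eq_some_getLast p.bypass.support_ne_nil]; simp

lemma exists_isCyclicPath_max [Finite V] {u v : V} (huv : G.Adj u v) :
    ∃ c, IsCyclicPath G c ∧ (∀ c', IsCyclicPath G c' → c'.length ≤ c.length) ∧ c ≠ [] := by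
  classical
  have := Fintype.ofFinite V
  have huv' : IsCyclicPath G [u, v] := ⟨by simp [huv.ne], by simp [huv, huv.symm]⟩
  have hle : ∀ c', IsCyclicPath G c' → c'.length ≤ Fintype.card V := fun c' hc' =>
    hc'.1.length_le_card
  have hspec := Nat.findGreatest_spec (P := fun m => ∃ c, IsCyclicPath G c ∧ c.length = m)
    (hle _ huv') ⟨_, huv', rfl⟩
  obtain ⟨c, hc, hcl⟩ := hspec
  have hmax : ∀ c', IsCyclicPath G c' → c'.length ≤ c.length := fun c' hc' =>
    hcl ▸ Nat.le_findGreatest (hle c' hc') ⟨c', hc', rfl⟩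
  refine ⟨c, hc, hmax, ?_⟩
  rintro rfl
  simpa using hmax _ huv'

lemma exists_cycleFrame [Finite V] [DecidableEq V] (hfree : P4P1Free G) {c : List V}
    (hc : IsCyclicPath G c) (hmax : ∀ c', IsCyclicPath G c' → c'.length ≤ c.length) {b : V}
    (hb : b ∉ c) : ∃ B N A P Y, b ∈ B ∧ CycleFrame G c B N A P Y := by
  classical
  have := Fintype.ofFinite V
  let B : Set V := {v | ConnIn G {w | w ∉ c} b v}
  let N : Finset V := Finset.univ.filter fun x => x ∈ c ∧ ∃ v ∈ B, G.Adj x v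
  let A : Finset V := N.image c.formPerm
  have hN : ∀ {x}, x ∈ N ↔ x ∈ c ∧ ∃ v ∈ B, G.Adj x v := by simp [N]
  refine ⟨B, N, A, Finset.univ.filter fun v => c.formPerm v ∈ N, Finset.univ.filter fun v => v ∉ N ∧
    ∃ a ∈ A, ∃ a' ∈ A, a ≠ a' ∧ G.Adj v a ∧ G.Adj v a', .refl hb, ?_⟩
  refine ⟨⟨hc, hmax, fun v hv => hv.right_mem, fun x hx => (hN.1 hx).1, ?_, ?_⟩, hfree,
    ⟨b, .refl hb⟩, by simp [A], by simp, by simp⟩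
  · intro x hx x' hx'
    obtain ⟨-, v, hv, hxv⟩ := hN.1 hx
    obtain ⟨-, v', hv', hxv'⟩ := hN.1 hx'
    obtain ⟨l, hl, hch, hlB, hhead, hlast⟩ := (hv.symm.trans hv').exists_path
    refine ⟨l, ?_, hl, hch, fun w hw => hv.trans (hlB w hw), fun w hw => ?_, fun w hw => ?_⟩
    · rintro rfl
      simp at hhead
    · exact Option.mem_unique hw hhead ▸ hxv
    · exact Option.mem_unique hw hlast ▸ hxv'.symm
  · intro v hv w hvw
    by_cases hw : w ∈ c
    · exact Or.inr (hN.2 ⟨hw, v, hv, hvw.symm⟩)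
    · exact Or.inl (hv.trans (.of_adj hv.right_mem hw hvw))

lemma CycleFrame.two_mul_le [Finite V] [DecidableEq V] {c : List V} {B : Set V} {N A P Y : Finset V}
    (h : CycleFrame G c B N A P Y) {t : ℝ} (htough : Tough t G) (ht : 0 ≤ t) (hc : c ≠ []) :
    t * 2 ≤ N.card := by
  obtain ⟨b, hb⟩ := h.nonempty
  obtain ⟨v, hv, hvN⟩ : ∃ v ∈ c, v ∉ N := by
    obtain ⟨v, hv⟩ := List.exists_mem_of_ne_nil c hc
    by_cases hvN : v ∈ N
    · exact ⟨_, List.formPerm_apply_mem_of_mem hv, h.next_notMem hvN⟩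
    · exact ⟨v, hv, hvN⟩
  have hbv : b ≠ v := fun hbv => h.notMem b hb (hbv ▸ hv)
  have hconn : ¬ ConnIn G (N : Set V)ᶜ b v := fun hconn => h.notMem v
    (hconn.closed (D := B) (fun a ha w hw _ haw => (h.closed a ha w haw).resolve_right hw) hb) hv
  have hbN : b ∉ N := fun hbN => h.notMem b hb (h.attach_mem b hbN)
  have := htough.mul_card_le ht (I := {b, v}) (Z := (N : Set V)) (by simp [hbN, hvN]) (by
    simp only [Finset.mem_insert, Finset.mem_singleton, forall_eq_or_imp, forall_eq]
    exact ⟨⟨fun h => (h rfl).elim, fun _ => hconn⟩, fun _ h => hconn h.symm, fun h => (h rfl).elim⟩)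
    (by rw [Finset.card_pair hbv])
  rw [Finset.card_pair hbv, Set.ncard_coe_finset] at this
  exact_mod_cast this

lemma IsCyclicPath.exists_isCycle {c : List V} (hc : IsCyclicPath G c) (hlen : 3 ≤ c.length) :
    ∃ (w : V) (C : G.Walk w w), C.IsCycle ∧ ∀ v ∈ c, v ∈ C.support := by
  obtain ⟨a, b, l, rfl⟩ : ∃ a b l, c = a :: b :: l := by
    match c, hlen with
    | a :: b :: l, _ => exact ⟨a, b, l, rfl⟩
  have hl : l ≠ [] := by
    rintro rfl
    simp at hlen
  have hch : (b :: l).IsChain G.Adj := hc.isChain.tail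
  obtain ⟨z, hz, p, hps⟩ : ∃ z, l.getLast hl = z ∧ ∃ p : G.Walk b z, p.support = b :: l :=
    ⟨_, (List.getLast_cons hl).symm, Walk.ofSupport (b :: l) (by simp) hch,
      Walk.support_ofSupport ..⟩
  have hab : G.Adj a b := (List.isChain_cons_cons.1 hc.isChain).1
  have hza : G.Adj z a :=
    (List.isChain_append.1 hc.isChain_concat).2.2 _ (by
      rw [List.getLast?_cons_cons, List.getLast?_eq_some_getLast (by simp),
        List.getLast_cons hl, hz]; simp) a (by simp)
  have hap : a ∉ p.support := by
    rw [hps]; exact (List.nodup_cons.1 hc.1).1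
  have hpath : (Walk.cons hab p).IsPath := .mk' (by
    rw [Walk.support_cons, hps]; exact hc.1)
  refine ⟨_, .cons hza (.cons hab p), (Walk.cons_isCycle_iff _ _).2 ⟨hpath, ?_⟩, ?_⟩
  · rw [Walk.edges_cons, List.mem_cons, not_or]
    refine ⟨fun h => ?_, fun h => hap (p.snd_mem_support_of_mem_edges h)⟩
    have hzb : z = b := by
      rcases Sym2.eq_iff.1 h with ⟨h, -⟩ | ⟨h, -⟩
      · exact (hza.ne h).elim
      · exact h
    exact (List.nodup_cons.1 (List.nodup_cons.1 hc.1).2).1 (hzb ▸ hz ▸ List.getLast_mem hl)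
  · intro v hv
    rw [Walk.support_cons, Walk.support_cons, hps]
    exact List.mem_cons_of_mem _ hv

/-- A `4.5`-tough `(P₄ ∪ P₁)`-free graph on at least three vertices is Hamiltonian. -/
lemma P4P1Free.exists_hamiltonian_cycle [Fintype V] {t : ℝ} (hfree : P4P1Free G) (ht : 4.5 ≤ t)
    (htough : Tough t G) (hcard : 3 ≤ Fintype.card V) :
    ∃ (w : V) (C : G.Walk w w), C.IsCycle ∧ ∀ v, v ∈ C.support := by
  classical
  obtain ⟨u, v, huv⟩ : ∃ u v, G.Adj u v := by
    by_contra! hcon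
    obtain ⟨u, v, huv⟩ := Fintype.exists_pair_of_one_lt_card (α := V) (by omega)
    have := htough.mul_card_le (by linarith) (I := {u, v}) (Z := ∅) (by simp) (by
      intro i _ j _ hij hconn
      obtain ⟨a, b, -, -, -, -, hab, -⟩ := hconn.exists_crossing (D := {i}) rfl hij.symm
      exact hcon a b hab) (by rw [Finset.card_pair huv])
    rw [Finset.card_pair huv, Set.ncard_empty] at this
    push_cast at this
    linarith
  obtain ⟨c, hc, hmax, hne⟩ := exists_isCyclicPath_max huv
  have hcov : ∀ b, b ∈ c := by
    by_contra! hcon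
    obtain ⟨b, hb⟩ := hcon
    obtain ⟨B, N, A, P, Y, -, h⟩ := exists_cycleFrame hfree hc hmax hb
    refine h.false_of_tough htough ht ?_
    have := h.two_mul_le htough (by linarith) hne
    have : (4 : ℝ) ≤ N.card := by linarith
    exact_mod_cast this
  obtain ⟨w, C, hC, hCc⟩ := hc.exists_isCycle (hcard.trans (by
    rw [← Finset.card_univ]
    exact (Finset.card_le_card fun v _ => List.mem_toFinset.2 (hcov v)).trans
      c.toFinset_card_le))
  exact ⟨w, C, hC, fun v => hCc v (hcov v)⟩

end

theorem stmt14 {V : Type*} [Fintype V] (G : SimpleGraph V) (t : ℝ) (ht : 4.5 ≤ t)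
    (htough : Tough t G) (hfree : P4P1Free G)
    (S : Set V) (hS : IsCutset G S)
    (s0 : ℕ) (x : Fin s0 → V) (hinj : Function.Injective x) (hxS : ∀ i, x i ∈ S)
    (hdeg : ∀ i : Fin s0, (Fintype.card V : ℝ) / (t + 1) - 1 <
      ({v : V | G.Adj (x i) v ∧ (v ∉ S ∨ ∃ j : Fin s0, j < i ∧ x j = v)}.ncard : ℝ)) :
    ∃ (w : V) (C : G.Walk w w), C.IsCycle ∧
      ∀ v : V, (v ∉ S ∨ ∃ i, x i = v) → v ∈ C.support := by
  have hle : S.ncard ≤ Fintype.card V := by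
    rw [← Nat.card_eq_fintype_card, ← Set.ncard_univ]
    exact Set.ncard_le_ncard (Set.subset_univ S)
  have hcard : 3 ≤ Fintype.card V := by
    have h := htough S hS
    have hS' : (2 : ℝ) ≤ ncomps G S := by exact_mod_cast hS
    have : (S.ncard : ℝ) ≤ Fintype.card V := by exact_mod_cast hle
    have : (3 : ℝ) ≤ Fintype.card V := by nlinarith
    exact_mod_cast this
  obtain ⟨w, C, hC, hv⟩ := hfree.exists_hamiltonian_cycle ht htough hcard
  exact ⟨w, C, hC, fun v _ => hv v⟩
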